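/- For every s ∈ {1,…,n}, the local cohomology module H^{2s+1}_I(S) is nonzero, i.e., (localCohomology I (2s+1)).obj (ModuleCat.of S S) is nontrivial. -/

import Mathlib

section LocalCohomology

open CategoryTheory Limits Opposite

namespace CategoryTheory.ProjectiveResolution

section LeftDerived

universe v u v' u'

variable {C : Type u} [Category.{v} C] [Abelian C] [EnoughProjectives C]
  {D : Type u'} [Category.{v'} D] [Abelian D]

/-- Left derived functors are computed as the homology of any projective resolution. -/
noncomputable def isoLeftDerivedHomology {X : C} (P : ProjectiveResolution X) (G : C ⥤ D)
    [G.Additive] (n : ℕ) :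
    (G.leftDerived n).obj X ≅ ((G.mapHomologicalComplex _).obj P.complex).homology n :=
  P.isoLeftDerivedObj G n

lemma isoLeftDerivedHomology_hom_naturality {X Y : C} (f : X ⟶ Y) (P : ProjectiveResolution X)
    (Q : ProjectiveResolution Y) (φ : P.complex ⟶ Q.complex)
    (comm : φ.f 0 ≫ Q.π.f 0 = P.π.f 0 ≫ f) (G : C ⥤ D) [G.Additive] (n : ℕ) :
    (G.leftDerived n).map f ≫ (Q.isoLeftDerivedHomology G n).hom =
      (P.isoLeftDerivedHomology G n).hom ≫
        HomologicalComplex.homologyMap ((G.mapHomologicalComplex _).map φ) n :=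
  isoLeftDerivedObj_hom_naturality f P Q φ comm G n

/-- A morphism out of a left derived functor, induced by a morphism out of the corresponding
term of a projective resolution that kills boundaries. -/
noncomputable def descLeftDerived {X : C} (P : ProjectiveResolution X) (G : C ⥤ D) [G.Additive]
    (n : ℕ) {A : D} (k : G.obj (P.complex.X n) ⟶ A)
    (hk : G.map (P.complex.d (n + 1) n) ≫ k = 0) : (G.leftDerived n).obj X ⟶ A :=
  (P.isoLeftDerivedHomology G n).hom ≫
    ((G.mapHomologicalComplex _).obj P.complex).homologyι n ≫
      ((G.mapHomologicalComplex _).obj P.complex).descOpcycles k (n + 1) (by simp) hk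

lemma leftDerived_map_descLeftDerived {X Y : C} (f : X ⟶ Y) (P : ProjectiveResolution X)
    (Q : ProjectiveResolution Y) (φ : P.complex ⟶ Q.complex)
    (comm : φ.f 0 ≫ Q.π.f 0 = P.π.f 0 ≫ f) (G : C ⥤ D) [G.Additive]
    (n : ℕ) {A : D} (k : G.obj (Q.complex.X n) ⟶ A)
    (hk : G.map (Q.complex.d (n + 1) n) ≫ k = 0) :
    (G.leftDerived n).map f ≫ Q.descLeftDerived G n k hk =
      P.descLeftDerived G n (G.map (φ.f n) ≫ k)
        (by rw [← Category.assoc, ← G.map_comp, ← φ.comm, G.map_comp, Category.assoc, hk,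
          comp_zero]) := by
  unfold descLeftDerived
  rw [← Category.assoc, isoLeftDerivedHomology_hom_naturality f P Q φ comm, Category.assoc,
    HomologicalComplex.homologyι_naturality_assoc]
  exact congrArg (fun z => (P.isoLeftDerivedHomology G n).hom ≫
    ((G.mapHomologicalComplex _).obj P.complex).homologyι n ≫ z)
    (HomologicalComplex.opcyclesMap_comp_descOpcycles
      (K := (G.mapHomologicalComplex _).obj P.complex)
      (L := (G.mapHomologicalComplex _).obj Q.complex) k (n + 1) (by simp) hk _)

lemma exists_eq_comp_of_descLeftDerived_eq_zero {X : C} (P : ProjectiveResolution X)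
    (G : C ⥤ D) [G.Additive] (n : ℕ) {A : D} [Injective A]
    (k : G.obj (P.complex.X (n + 1)) ⟶ A)
    (hk : G.map (P.complex.d (n + 2) (n + 1)) ≫ k = 0)
    (h : P.descLeftDerived G (n + 1) k hk = 0) :
    ∃ x : G.obj (P.complex.X n) ⟶ A, G.map (P.complex.d (n + 1) n) ≫ x = k := by
  set K := (G.mapHomologicalComplex _).obj P.complex with hK
  have h1 : K.homologyι (n + 1) ≫ K.descOpcycles k (n + 2) (by simp) hk = 0 := by
    rw [descLeftDerived] at h
    exact (cancel_epi (P.isoLeftDerivedHomology G (n + 1)).hom).1 (h.trans comp_zero.symm)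
  have h2 : K.iCycles (n + 1) ≫ k = 0 := by
    rw [← K.p_descOpcycles k (n + 2) (by simp) hk, ← Category.assoc, ← K.homology_π_ι,
      Category.assoc, h1, comp_zero]
  have ex : (ShortComplex.mk (K.iCycles (n + 1)) (K.d (n + 1) n) (K.iCycles_d _ _)).Exact :=
    ShortComplex.exact_of_f_is_kernel _ (K.cyclesIsKernel (n + 1) n (by simp))
  exact ⟨ex.descToInjective k h2, ex.comp_descToInjective k h2⟩

end LeftDerived
end CategoryTheory.ProjectiveResolution

section Bridge
variable {R : Type} [CommRing R]

open Abelian in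
theorem ModuleCat.exists_ext_family (Y : ModuleCat.{0} R) (n : ℕ) {X : ModuleCat.{0} R}
    (e : Abelian.Ext X Y (n + 1)) :
    ∃ x : (((_root_.Ext R (ModuleCat.{0} R) (n + 1)).obj (op X)).obj Y),
      ∀ {X' : ModuleCat.{0} R} (f : X' ⟶ X),
        ((_root_.Ext R (ModuleCat.{0} R) (n + 1)).map f.op).app Y x = 0 →
          (Ext.mk₀ f).comp e (zero_add _) = 0 := by
  let Q := CategoryTheory.projectiveResolution X
  let G := ((linearYoneda R (ModuleCat.{0} R)).obj Y).rightOp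
  obtain ⟨c, hc, rfl⟩ := Q.extMk_surjective e (n + 2) rfl
  have : Projective (ModuleCat.of R R) := inferInstance
  let toMap : ∀ {Z : ModuleCat.{0} R}, (Z ⟶ Y) → (G.obj Z ⟶ op (ModuleCat.of R R)) :=
    fun c => (ModuleCat.ofHom (LinearMap.toSpanSingleton R _ c)).op
  have htoMap : ∀ {Z Z' : ModuleCat.{0} R} (g : Z' ⟶ Z) (c : Z ⟶ Y),
      G.map g ≫ toMap c = toMap (g ≫ c) := by
    intro Z Z' g c
    apply Quiver.Hom.unop_inj
    apply ModuleCat.hom_ext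
    apply LinearMap.ext_ring
    change g ≫ ((1 : R) • c) = (1 : R) • (g ≫ c)
    rw [one_smul, one_smul]
  have hk : ∀ {X' : ModuleCat.{0} R} (P : ProjectiveResolution X') (c : P.complex.X (n + 1) ⟶ Y)
      (hc : P.complex.d (n + 2) (n + 1) ≫ c = 0),
      G.map (P.complex.d (n + 2) (n + 1)) ≫ toMap c = 0 := by
    intro X' P c hc
    rw [htoMap, hc]
    apply Quiver.Hom.unop_inj
    apply ModuleCat.hom_ext
    apply LinearMap.ext_ring
    change (1 : R) • (0 : P.complex.X (n + 2) ⟶ Y) = 0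
    rw [smul_zero]
  refine ⟨(Q.descLeftDerived G (n + 1) (toMap c) (hk Q c hc)).unop (1 : R), ?_⟩
  intro X' f hf
  let P := CategoryTheory.projectiveResolution X'
  let φ : ProjectiveResolution.Hom P Q f :=
    ⟨ProjectiveResolution.lift f P Q, ProjectiveResolution.lift_commutes_zero f P Q⟩
  have h0 : (G.leftDerived (n + 1)).map f ≫
      Q.descLeftDerived G (n + 1) (toMap c) (hk Q c hc) = 0 := by
    apply Quiver.Hom.unop_inj
    ext
    exact hf
  rw [ProjectiveResolution.leftDerived_map_descLeftDerived f P Q φ.hom 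
    (ProjectiveResolution.lift_commutes_zero f P Q)] at h0
  obtain ⟨x, hx⟩ := ProjectiveResolution.exists_eq_comp_of_descLeftDerived_eq_zero _ _ _ _ _ h0
  rw [ProjectiveResolution.mk₀_comp_extMk _ _ _ _ φ,
    ProjectiveResolution.extMk_eq_zero_iff _ _ _ _ _ n rfl]
  refine ⟨x.unop (1 : R), ?_⟩
  have h1 : P.complex.d (n + 1) n ≫ (x.unop (1 : R) : P.complex.X n ⟶ Y) =
      (1 : R) • (φ.hom.f (n + 1) ≫ c) :=
    congrArg (fun g => g.unop (1 : R)) (hx.trans (htoMap _ _))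
  rwa [one_smul] at h1

open Abelian in
/-- A class in `Ext (R ⧸ I ^ t) M (n + 1)` all of whose pullbacks to higher powers are nonzero
gives a nonzero element of local cohomology. -/
theorem nontrivial_localCohomology_of_ext (I : Ideal R) (M : ModuleCat.{0} R) (n t : ℕ)
    (e : Abelian.Ext (ModuleCat.of R (R ⧸ I ^ t)) M (n + 1))
    (he : ∀ (t' : ℕ) (h : t ≤ t'), (Ext.mk₀ (ModuleCat.ofHom
      (Submodule.mapQ (I ^ t') (I ^ t) LinearMap.id (Ideal.pow_le_pow_right h)))).comp e
        (zero_add _) ≠ 0) :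
    Nontrivial ((localCohomology I (n + 1)).obj M) := by
  obtain ⟨x, hx⟩ := ModuleCat.exists_ext_family M n e
  by_contra hn
  rw [not_nontrivial_iff_subsingleton] at hn
  let F := localCohomology.diagram (localCohomology.idealPowersDiagram I) (n + 1)
  have hcol := isColimitOfPreserves ((evaluation (ModuleCat.{0} R) (ModuleCat.{0} R)).obj M)
    (colimit.isColimit F)
  have : IsFiltered ℕᵒᵖᵒᵖ := inferInstance
  have : PreservesColimitsOfShape ℕᵒᵖᵒᵖ (forget (ModuleCat.{0} R)) := inferInstance
  obtain ⟨k, g, g', hg⟩ := Concrete.isColimit_exists_of_rep_eq _ hcol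
    (i := op (op t)) (j := op (op t)) x (0 : ((F.obj (op (op t))).obj M))
    (Subsingleton.elim (α := (localCohomology I (n + 1)).obj M) _ _)
  rw [map_zero] at hg
  exact he k.unop.unop g.unop.unop.down.down (hx _ hg)

end Bridge

section ExtVanishing

variable {R : Type} [CommRing R]

/-- The projection `R ⧸ I ^ t' ⟶ R ⧸ I ^ t` for `t ≤ t'`. -/
noncomputable abbrev quotPowMap (I : Ideal R) {t t' : ℕ} (h : t ≤ t') :
    ModuleCat.of R (R ⧸ I ^ t') ⟶ ModuleCat.of R (R ⧸ I ^ t) :=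
  ModuleCat.ofHom (Submodule.mapQ (I ^ t') (I ^ t) LinearMap.id (Ideal.pow_le_pow_right h))

lemma quotPowMap_comp (I : Ideal R) {t t' t'' : ℕ} (h : t ≤ t') (h' : t' ≤ t'') :
    quotPowMap I h' ≫ quotPowMap I h = quotPowMap I (h.trans h') := by
  apply ModuleCat.hom_ext
  apply Submodule.linearMap_qext
  ext
  rfl

open Abelian

/-- A class in `Ext (R ⧸ I ^ t) M i` that becomes `g`-power torsion after pulling back to some
higher power of `I`. -/
def ExtNegligible (I : Ideal R) (g : R) {t : ℕ} {M : ModuleCat.{0} R} {i : ℕ}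
    (e : Ext (ModuleCat.of R (R ⧸ I ^ t)) M i) : Prop :=
  ∃ (t' : ℕ) (h : t ≤ t') (r : ℕ),
    g ^ r • (Ext.mk₀ (quotPowMap I h)).comp e (zero_add i) = 0

/-- All classes in `Ext (R ⧸ I ^ t) M i`, for all `t`, are negligible. In other words, the
localization at `g` of the `i`-th local cohomology of `M` vanishes. -/
def ExtVanishes (I : Ideal R) (g : R) (i : ℕ) (M : ModuleCat.{0} R) : Prop :=
  ∀ (t : ℕ) (e : Ext (ModuleCat.of R (R ⧸ I ^ t)) M i), ExtNegligible I g e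

variable {I : Ideal R} {g : R}

lemma ExtNegligible.zero {t : ℕ} {M : ModuleCat.{0} R} {i : ℕ} :
    ExtNegligible I g (0 : Ext (ModuleCat.of R (R ⧸ I ^ t)) M i) :=
  ⟨t, le_rfl, 0, by simp⟩

lemma ExtNegligible.comp {t : ℕ} {M N : ModuleCat.{0} R} {i j k : ℕ}
    {e : Ext (ModuleCat.of R (R ⧸ I ^ t)) M i} (he : ExtNegligible I g e)
    (x : Ext M N j) (h : i + j = k) : ExtNegligible I g (e.comp x h) := by
  obtain ⟨t', ht, r, hr⟩ := he
  refine ⟨t', ht, r, ?_⟩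
  rw [← Ext.comp_assoc _ _ _ (zero_add i) h (by omega), ← Ext.smul_comp, hr, Ext.zero_comp]

lemma ExtNegligible.of_smul_comp {t t' : ℕ} (h : t ≤ t') (r : ℕ) {M : ModuleCat.{0} R} {i : ℕ}
    {e : Ext (ModuleCat.of R (R ⧸ I ^ t)) M i}
    (he : ExtNegligible I g (g ^ r • (Ext.mk₀ (quotPowMap I h)).comp e (zero_add i))) :
    ExtNegligible I g e := by
  obtain ⟨t'', h', r', hr⟩ := he
  refine ⟨t'', h.trans h', r' + r, ?_⟩
  rw [Ext.comp_smul, ← Ext.comp_assoc _ _ _ (zero_add 0) (zero_add i) (by omega),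
    Ext.mk₀_comp_mk₀, quotPowMap_comp, smul_smul, ← pow_add] at hr
  exact hr

lemma ExtVanishes.of_exact {A B C : ModuleCat.{0} R} {i j k a b : ℕ} {x : Ext A B a}
    {y : Ext B C b} (hx : i + a = j) (hy : j + b = k)
    (hxy : ∀ (t : ℕ) (e : Ext (ModuleCat.of R (R ⧸ I ^ t)) B j), e.comp y hy = 0 →
      ∃ e', Ext.comp e' x hx = e)
    (hA : ExtVanishes I g i A) (hC : ExtVanishes I g k C) : ExtVanishes I g j B := by
  intro t e
  obtain ⟨t', h, r, hr⟩ := hC t (e.comp y hy)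
  rw [← Ext.comp_assoc _ _ _ (zero_add j) hy (by omega), ← Ext.smul_comp] at hr
  obtain ⟨e', he'⟩ := hxy _ _ hr
  refine ExtNegligible.of_smul_comp h r ?_
  rw [← he']
  exact (hA _ e').comp x hx

variable {A B C : Type} [AddCommGroup A] [AddCommGroup B] [AddCommGroup C] [Module R A]
  [Module R B] [Module R C]

/-- The short complex of modules attached to an exact pair of linear maps. -/
abbrev moduleShortComplex {u : A →ₗ[R] B} {v : B →ₗ[R] C} (huv : Function.Exact u v) :
    ShortComplex (ModuleCat.{0} R) :=
  ShortComplex.mk (ModuleCat.ofHom u) (ModuleCat.ofHom v)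
    (ModuleCat.hom_ext (LinearMap.ext fun a => huv.apply_apply_eq_zero a))

lemma moduleShortComplex_shortExact {u : A →ₗ[R] B} {v : B →ₗ[R] C}
    (hu : Function.Injective u) (huv : Function.Exact u v) (hv : Function.Surjective v) :
    (moduleShortComplex huv).ShortExact where
  exact := (ShortComplex.ShortExact.moduleCat_exact_iff_function_exact _).2 huv
  mono_f := (ModuleCat.mono_iff_injective _).2 hu
  epi_g := (ModuleCat.epi_iff_surjective _).2 hv

variable {u : A →ₗ[R] B} {v : B →ₗ[R] C} (hu : Function.Injective u) (huv : Function.Exact u v)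
  (hv : Function.Surjective v) 

include hu huv hv in
lemma ExtVanishes.middle {i : ℕ} (hA : ExtVanishes I g i (ModuleCat.of R A))
    (hC : ExtVanishes I g i (ModuleCat.of R C)) : ExtVanishes I g i (ModuleCat.of R B) :=
  .of_exact (add_zero i) (add_zero i) (fun _ e he => Ext.covariant_sequence_exact₂ _
    (moduleShortComplex_shortExact hu huv hv) e he) hA hC

include hu huv hv in
lemma ExtVanishes.right {i : ℕ} (hB : ExtVanishes I g i (ModuleCat.of R B))
    (hA : ExtVanishes I g (i + 1) (ModuleCat.of R A)) : ExtVanishes I g i (ModuleCat.of R C) :=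
  .of_exact (add_zero i) rfl (fun _ e he => Ext.covariant_sequence_exact₃ _
    (moduleShortComplex_shortExact hu huv hv) e rfl he) hB hA

include hu huv hv in
lemma ExtVanishes.left {i : ℕ} (hC : ExtVanishes I g i (ModuleCat.of R C))
    (hB : ExtVanishes I g (i + 1) (ModuleCat.of R B)) :
    ExtVanishes I g (i + 1) (ModuleCat.of R A) :=
  .of_exact rfl (add_zero _) (fun _ e he => Ext.covariant_sequence_exact₁ _
    (moduleShortComplex_shortExact hu huv hv) e he rfl) hC hB

lemma extVanishes_of_bijective {f : R} (hf : f ∈ I) (i : ℕ)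
    (hbij : Function.Bijective fun m : A => f • m) : ExtVanishes I g i (ModuleCat.of R A) := by
  intro t e
  convert ExtNegligible.zero
  have h1 : f ^ t • e = 0 := by
    have h0 : (f ^ t • 𝟙 (ModuleCat.of R (R ⧸ I ^ t))) = 0 := by
      apply ModuleCat.hom_ext
      apply Submodule.linearMap_qext
      ext
      change Submodule.Quotient.mk (p := I ^ t) (f ^ t • (1 : R)) = 0
      rw [Submodule.Quotient.mk_eq_zero, smul_eq_mul, mul_one]
      exact Ideal.pow_mem_pow hf t
    rw [← Ext.mk₀_id_comp e, ← Ext.smul_comp, ← Ext.mk₀_smul, h0, Ext.mk₀_zero, Ext.zero_comp]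
  let φ : Module.End R A := algebraMap R _ (f ^ t)
  have hφ : Function.Bijective φ := by
    have : (φ : A → A) = (fun m : A => f • m)^[t] := by
      funext m
      rw [smul_iterate]
      rfl
    rw [this]
    exact hbij.iterate t
  let ψ := (LinearEquiv.ofBijective φ hφ).toModuleIso
  have h2 : e.comp (Ext.mk₀ ψ.hom) (add_zero i) = 0 := by
    have : ψ.hom = f ^ t • 𝟙 (ModuleCat.of R A) := by
      apply ModuleCat.hom_ext
      ext
      rfl
    rw [this, Ext.mk₀_smul, Ext.comp_smul, Ext.comp_mk₀_id, h1]
  calc e = (e.comp (Ext.mk₀ ψ.hom) (add_zero i)).comp (Ext.mk₀ ψ.inv) (add_zero i) := by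
        rw [Ext.comp_assoc _ _ _ (add_zero i) (add_zero 0) (by omega), Ext.mk₀_comp_mk₀,
          ψ.hom_inv_id, Ext.comp_mk₀_id]
    _ = 0 := by rw [h2, Ext.zero_comp]

end ExtVanishing

section TorsionVanishing

variable {R : Type} [CommRing R] {I : Ideal R} {g : R}

open Abelian

/-- The submodule of elements killed by a power of the ideal `I`. -/
def idealPowTorsion (I : Ideal R) (M : Type) [AddCommGroup M] [Module R M] : Submodule R M where
  carrier := {m | ∃ t : ℕ, ∀ a ∈ I ^ t, a • m = 0}
  zero_mem' := ⟨0, fun a _ => smul_zero a⟩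
  add_mem' := by
    rintro x y ⟨t, ht⟩ ⟨t', ht'⟩
    refine ⟨max t t', fun a ha => ?_⟩
    rw [smul_add, ht a (Ideal.pow_le_pow_right (le_max_left t t') ha),
      ht' a (Ideal.pow_le_pow_right (le_max_right t t') ha), add_zero]
  smul_mem' := by
    rintro c x ⟨t, ht⟩
    refine ⟨t, fun a ha => ?_⟩
    rw [smul_comm, ht a ha, smul_zero]

lemma exists_pow_smul_ext_eq_zero [IsNoetherianRing R] {M : ModuleCat.{0} R}
    (hM : ∀ m : M, ∃ r : ℕ, g ^ r • m = 0) (i : ℕ) (N : ModuleCat.{0} R) [Module.Finite R N]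
    (e : Ext N M i) : ∃ r : ℕ, g ^ r • e = 0 := by
  induction i generalizing N with
  | zero =>
    obtain ⟨φ, rfl⟩ := (Ext.mk₀_bijective N M).2 e
    obtain ⟨s, hs⟩ := Module.Finite.fg_top (R := R) (M := N)
    choose r hr using fun x : N => hM (φ x)
    refine ⟨s.sup r, ?_⟩
    rw [← Ext.mk₀_smul]
    suffices h : g ^ s.sup r • φ = 0 by rw [h, Ext.mk₀_zero]
    apply ModuleCat.hom_ext
    refine LinearMap.ext_on hs fun x hx => ?_
    change g ^ (s.sup r) • φ x = 0
    obtain ⟨c, hc⟩ := Nat.exists_eq_add_of_le (Finset.le_sup (f := r) hx)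
    rw [hc, add_comm, pow_add, mul_smul, hr, smul_zero]
  | succ n ih =>
    obtain ⟨N, _, _, _, _, f, surjf⟩ := Module.exists_finite_presentation R N
    let exac := LinearMap.shortExact_shortComplexKer surjf
    obtain ⟨x, hx⟩ := precomp_extClass_surjective_of_projective_X₂ M exac n e
    have : Module.Finite R (LinearMap.shortComplexKer f).X₁ :=
      inferInstanceAs (Module.Finite R (LinearMap.ker f))
    obtain ⟨r, hr⟩ := ih _ x
    refine ⟨r, ?_⟩
    have hx' : exac.extClass.comp x (add_comm 1 n) = e := hx
    rw [← hx', ← Ext.comp_smul, hr, Ext.comp_zero]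

lemma extVanishes_of_torsion [IsNoetherianRing R] {M : ModuleCat.{0} R}
    (hM : ∀ m : M, ∃ r : ℕ, g ^ r • m = 0) (i : ℕ) : ExtVanishes I g i M := by
  intro t e
  have : Module.Finite R (ModuleCat.of R (R ⧸ I ^ t)) :=
    inferInstanceAs (Module.Finite R (R ⧸ I ^ t))
  obtain ⟨r, hr⟩ := exists_pow_smul_ext_eq_zero hM i _ e
  exact ⟨t, le_rfl, r, by rw [← Ext.comp_smul, hr, Ext.comp_zero]⟩

lemma exists_pow_inf_le_pow_smul [IsNoetherianRing R] (I J : Ideal R) (k : ℕ) :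
    ∃ m, I ^ m ⊓ J ≤ I ^ k * J := by
  obtain ⟨c, hc⟩ := I.exists_pow_inf_eq_pow_smul (M := R) J
  refine ⟨k + c, ?_⟩
  have := hc (k + c) (by omega)
  rw [smul_eq_mul, Ideal.mul_top] at this
  rw [this, Nat.add_sub_cancel]
  exact Ideal.mul_mono le_rfl inf_le_right

lemma injective_idealPowTorsion [IsNoetherianRing R] (E : Type) [AddCommGroup E] [Module R E]
    [Module.Injective R E] : Module.Injective R (idealPowTorsion I E) := by
  refine Module.Baer.injective fun J φ => ?_
  obtain ⟨k, hk⟩ : ∃ k : ℕ, ∀ a ∈ I ^ k, ∀ x, a • φ x = 0 := by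
    obtain ⟨s, hs⟩ := Module.Finite.fg_top (R := R) (M := J)
    choose r hr using fun x : J => (φ x).2
    refine ⟨s.sup r, fun a ha x => ?_⟩
    have hx : x ∈ Submodule.span R (s : Set J) := hs ▸ Submodule.mem_top
    induction hx using Submodule.span_induction with
    | mem x hx =>
      exact Subtype.ext (hr x a (Ideal.pow_le_pow_right (Finset.le_sup (f := r) hx) ha))
    | zero => simp
    | add x y _ _ h1 h2 => rw [map_add, smul_add, h1, h2, add_zero]
    | smul c x _ h => rw [map_smul, smul_comm, h, smul_zero]
  obtain ⟨m, hm⟩ := exists_pow_inf_le_pow_smul I J k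
  have hφ : ∀ x : J, (x : R) ∈ I ^ m → φ x = 0 := by
    intro x hx
    have h2 : I ^ k * J ≤ (LinearMap.ker φ).map J.subtype := by
      refine Ideal.mul_le.2 fun a ha b hb => ⟨a • ⟨b, hb⟩, ?_, rfl⟩
      change φ (a • ⟨b, hb⟩) = 0
      rw [map_smul, hk a ha]
    obtain ⟨y, hy, hyx⟩ := h2 (hm ⟨hx, x.2⟩)
    rwa [← Subtype.ext hyx]
  let p : J →ₗ[R] (R ⧸ I ^ m) := (I ^ m).mkQ ∘ₗ J.subtype
  have hp : LinearMap.ker p ≤ LinearMap.ker ((idealPowTorsion I E).subtype ∘ₗ φ) := by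
    intro x hx
    have : (x : R) ∈ I ^ m := (Submodule.Quotient.mk_eq_zero _).1 hx
    simp [hφ x this]
  obtain ⟨ψ, hψ⟩ := Module.Injective.out (R := R) ((LinearMap.ker p).liftQ p le_rfl)
    (LinearMap.ker_eq_bot.1 (Submodule.ker_liftQ_eq_bot _ _ _ le_rfl))
    ((LinearMap.ker p).liftQ _ hp)
  refine ⟨LinearMap.codRestrict _ (ψ ∘ₗ (I ^ m).mkQ) fun x => ⟨m, fun a ha => ?_⟩, ?_⟩
  · rw [← map_smul, LinearMap.comp_apply, Submodule.mkQ_apply,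
      (Submodule.Quotient.mk_eq_zero _).2 (show a • x ∈ I ^ m from Ideal.mul_mem_right _ _ ha),
      map_zero]
  · intro x hx
    exact Subtype.ext (hψ (Submodule.Quotient.mk ⟨x, hx⟩))

lemma extVanishes_one_of_exact {A B C : Type} [AddCommGroup A] [AddCommGroup B] [AddCommGroup C]
    [Module R A] [Module R B] [Module R C] {u : A →ₗ[R] B} {v : B →ₗ[R] C}
    (hu : Function.Injective u) (huv : Function.Exact u v) (hv : Function.Surjective v)
    (hB : idealPowTorsion I B = ⊤) [Injective (ModuleCat.of R B)] :
    ExtVanishes I g 1 (ModuleCat.of R A) := by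
  have hS := moduleShortComplex_shortExact hu huv hv
  intro t e
  obtain ⟨y, hy⟩ := Ext.covariant_sequence_exact₁ _ hS e (Ext.eq_zero_of_injective _)
    (n₀ := 0) rfl
  obtain ⟨φ, rfl⟩ := (Ext.mk₀_bijective _ _).2 y
  obtain ⟨b, hb⟩ := hv (φ (Submodule.Quotient.mk (1 : R)))
  obtain ⟨c, hc⟩ : b ∈ idealPowTorsion I B := hB ▸ Submodule.mem_top
  let ψ : ModuleCat.of R (R ⧸ I ^ (max t c)) ⟶ ModuleCat.of R B :=
    ModuleCat.ofHom ((I ^ (max t c)).liftQ (LinearMap.toSpanSingleton R B b) fun a ha =>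
      hc a (Ideal.pow_le_pow_right (le_max_right t c) ha))
  have hψ : quotPowMap I (le_max_left t c) ≫ φ = ψ ≫ ModuleCat.ofHom v := by
    apply ModuleCat.hom_ext
    apply Submodule.linearMap_qext
    apply LinearMap.ext_ring
    change φ (Submodule.Quotient.mk (1 : R)) = v ((1 : R) • b)
    rw [one_smul, hb]
  refine ⟨max t c, le_max_left t c, 0, ?_⟩
  rw [pow_zero, one_smul, ← hy, ← Ext.comp_assoc _ _ _ (zero_add 0) _ (by omega),
    Ext.mk₀_comp_mk₀, hψ, ← Ext.mk₀_comp_mk₀, Ext.comp_assoc _ _ _ (zero_add 0) (zero_add 1)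
      (by omega)]
  have : (Ext.mk₀ (ModuleCat.ofHom v)).comp hS.extClass (zero_add 1) = 0 := hS.comp_extClass
  rw [this, Ext.comp_zero]

/-- An ideal-power-torsion module embeds in an injective ideal-power-torsion module. -/
lemma exists_injective_idealPowTorsion_eq_top [IsNoetherianRing R] (M : Type) [AddCommGroup M]
    [Module R M] (hM : idealPowTorsion I M = ⊤) :
    ∃ (T : Type) (_ : AddCommGroup T) (_ : Module R T) (u : M →ₗ[R] T),
      Function.Injective u ∧ idealPowTorsion I T = ⊤ ∧ Module.Injective R T := by
  let E := Injective.under (ModuleCat.of R M)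
  have : Module.Injective R E :=
    (Module.injective_iff_injective_object R E).2 (inferInstanceAs (Injective E))
  let ι : M →ₗ[R] E := (Injective.ι (ModuleCat.of R M)).hom
  have hι : Function.Injective ι := (ModuleCat.mono_iff_injective _).1 inferInstance
  refine ⟨idealPowTorsion I E, inferInstance, inferInstance, LinearMap.codRestrict _ ι fun x => ?_,
    fun x y h => hι (congrArg Subtype.val h), ?_, injective_idealPowTorsion E⟩
  · obtain ⟨t, ht⟩ : x ∈ idealPowTorsion I M := hM ▸ Submodule.mem_top
    exact ⟨t, fun a ha => by rw [← map_smul, ht a ha, map_zero]⟩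
  · refine Submodule.eq_top_iff'.2 fun x => ?_
    obtain ⟨t, ht⟩ := x.2
    exact ⟨t, fun a ha => Subtype.ext (ht a ha)⟩

lemma extVanishes_of_idealPowTorsion [IsNoetherianRing R] (i : ℕ) (M : Type) [AddCommGroup M]
    [Module R M] (hM : idealPowTorsion I M = ⊤) : ExtVanishes I g (i + 1) (ModuleCat.of R M) := by
  induction i generalizing M with
  | zero =>
    obtain ⟨T, _, _, u, hu, hT, hT'⟩ := exists_injective_idealPowTorsion_eq_top M hM
    have := (Module.injective_iff_injective_object R T).1 hT'
    exact extVanishes_one_of_exact hu (LinearMap.exact_map_mkQ_range u)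
      (Submodule.mkQ_surjective _) hT
  | succ i ih =>
    obtain ⟨T, _, _, u, hu, hT, hT'⟩ := exists_injective_idealPowTorsion_eq_top M hM
    have := (Module.injective_iff_injective_object R T).1 hT'
    refine ExtVanishes.left hu (LinearMap.exact_map_mkQ_range u)
      (Submodule.mkQ_surjective _) (ih _ ?_) fun t e => ?_
    · refine Submodule.eq_top_iff'.2 fun x => ?_
      obtain ⟨x, rfl⟩ := Submodule.mkQ_surjective _ x
      obtain ⟨t, ht⟩ : x ∈ idealPowTorsion I T := hT ▸ Submodule.mem_top
      exact ⟨t, fun a ha => by rw [← map_smul, ht a ha, map_zero]⟩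
    · rw [Ext.eq_zero_of_injective e]
      exact ExtNegligible.zero

lemma exists_pow_smul_mem_idealPowTorsion [IsNoetherianRing R] {L : List R}
    (hg : ∀ x ∈ I, g * x ∈ Ideal.span {f | f ∈ L}) {M : Type} [AddCommGroup M]
    [Module R M] (hM : ∀ f ∈ L, ∀ m : M, ∃ a : ℕ, f ^ a • m = 0) (x : M) :
    ∃ c : ℕ, g ^ c • x ∈ idealPowTorsion I M := by
  have h : Ideal.span {g} * I ≤ (Ideal.torsionOf R M x).radical := by
    rw [Ideal.span_singleton_mul_le_iff]
    intro y hy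
    refine Ideal.span_le.2 (fun f hf => ?_) (hg y hy)
    obtain ⟨a, ha⟩ := hM f hf x
    exact ⟨a, ha⟩
  obtain ⟨c, hc⟩ := Ideal.exists_pow_le_of_le_radical_of_fg h
    ((isNoetherianRing_iff_ideal_fg R).1 inferInstance _)
  refine ⟨c, c, fun a ha => ?_⟩
  rw [smul_smul, mul_comm]
  rw [mul_pow] at hc
  exact hc (Ideal.mul_mem_mul (Ideal.pow_mem_pow (Ideal.mem_span_singleton_self g) c) ha)

/-- A module whose elements are killed by powers of elements generating an ideal that contains
`g • I` has negligible higher local cohomology. -/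
lemma extVanishes_of_forall_torsion [IsNoetherianRing R] {L : List R}
    (hg : ∀ x ∈ I, g * x ∈ Ideal.span {f | f ∈ L}) (i : ℕ) (M : Type) [AddCommGroup M]
    [Module R M] (hM : ∀ f ∈ L, ∀ m : M, ∃ a : ℕ, f ^ a • m = 0) :
    ExtVanishes I g (i + 1) (ModuleCat.of R M) := by
  refine ExtVanishes.middle (idealPowTorsion I M).injective_subtype
    (LinearMap.exact_subtype_mkQ _) (Submodule.mkQ_surjective _)
    (extVanishes_of_idealPowTorsion i _ ?_) (extVanishes_of_torsion ?_ _)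
  · refine Submodule.eq_top_iff'.2 fun x => ?_
    obtain ⟨t, ht⟩ := x.2
    exact ⟨t, fun a ha => Subtype.ext (ht a ha)⟩
  · intro x
    obtain ⟨x, rfl⟩ := Submodule.mkQ_surjective _ x
    obtain ⟨c, hc⟩ := exists_pow_smul_mem_idealPowTorsion hg hM x
    exact ⟨c, by rwa [← map_smul, Submodule.mkQ_apply, Submodule.Quotient.mk_eq_zero]⟩

end TorsionVanishing

section Nonvanishing

variable {R : Type} [CommRing R] {I : Ideal R} {g : R}

open Abelian

/-- Every element of `M` is killed by a power of `f`. -/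
def IsPowTorsion (f : R) (M : Type) [AddCommGroup M] [Module R M] : Prop :=
  ∀ m : M, ∃ a : ℕ, f ^ a • m = 0

variable {M : Type} [AddCommGroup M] [Module R M]

lemma IsPowTorsion.submodule {f : R} (h : IsPowTorsion f M) (N : Submodule R M) :
    IsPowTorsion f N := fun m => by
  obtain ⟨a, ha⟩ := h m
  exact ⟨a, Subtype.ext ha⟩

variable (M) in
/-- The localization map `M → M_f`. -/
noncomputable abbrev awayMap (f : R) : M →ₗ[R] LocalizedModule (Submonoid.powers f) M :=
  LocalizedModule.mkLinearMap (Submonoid.powers f) M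

variable (M) in
/-- The cokernel of the localization map `M → M_f`. -/
abbrev AwayCoker (f : R) : Type :=
  LocalizedModule (Submonoid.powers f) M ⧸ LinearMap.range (awayMap M f)

lemma exists_pow_smul_eq_awayMap (f : R) (x : LocalizedModule (Submonoid.powers f) M) :
    ∃ (a : ℕ) (m : M), f ^ a • x = awayMap M f m := by
  obtain ⟨⟨m, ⟨_, a, rfl⟩⟩, h⟩ := IsLocalizedModule.surj (Submonoid.powers f) (awayMap M f) x
  exact ⟨a, m, h⟩

lemma exists_pow_smul_eq_zero_of_awayMap_eq_zero {f : R} {m : M} (h : awayMap M f m = 0) :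
    ∃ a : ℕ, f ^ a • m = 0 := by
  obtain ⟨⟨_, a, rfl⟩, h⟩ := (IsLocalizedModule.eq_zero_iff (Submonoid.powers f) (awayMap M f)).1 h
  exact ⟨a, h⟩

lemma bijective_smul_localizedModule (f : R) :
    Function.Bijective fun m : LocalizedModule (Submonoid.powers f) M => f • m :=
  (Module.End.isUnit_iff _).1
    (IsLocalizedModule.map_units (awayMap M f) ⟨f, Submonoid.mem_powers f⟩)

lemma isPowTorsion_ker_awayMap (f : R) : IsPowTorsion f (LinearMap.ker (awayMap M f)) := fun m => by
  obtain ⟨a, ha⟩ := exists_pow_smul_eq_zero_of_awayMap_eq_zero m.2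
  exact ⟨a, Subtype.ext ha⟩

lemma isPowTorsion_awayCoker_self (f : R) : IsPowTorsion f (AwayCoker M f) := fun x => by
  obtain ⟨x, rfl⟩ := Submodule.mkQ_surjective _ x
  obtain ⟨a, m, h⟩ := exists_pow_smul_eq_awayMap f x
  refine ⟨a, ?_⟩
  rw [← map_smul, Submodule.mkQ_apply, Submodule.Quotient.mk_eq_zero, h]
  exact LinearMap.mem_range_self _ m

lemma IsPowTorsion.awayCoker {h : R} (hM : IsPowTorsion h M) (f : R) :
    IsPowTorsion h (AwayCoker M f) := fun x => by
  obtain ⟨x, rfl⟩ := Submodule.mkQ_surjective _ x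
  obtain ⟨a, m, hx⟩ := exists_pow_smul_eq_awayMap f x
  obtain ⟨b, hb⟩ := hM m
  refine ⟨b, ?_⟩
  have : h ^ b • x = 0 := by
    have hinj := (bijective_smul_localizedModule (M := M) f).injective.iterate a
    refine hinj ?_
    simp only [smul_iterate]
    rw [smul_comm, hx, ← map_smul, hb, map_zero, smul_zero]
  rw [← map_smul, this, map_zero]

lemma extVanishes_of_length_lt [IsNoetherianRing R] {L : List R}
    (hg : ∀ x ∈ I, g * x ∈ Ideal.span {f | f ∈ L}) (l : List R) (hl : ∀ f ∈ l, f ∈ I)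
    (M : Type) [AddCommGroup M] [Module R M] (hM : ∀ f ∈ L, f ∈ l ∨ IsPowTorsion f M)
    (i : ℕ) (hi : l.length < i) : ExtVanishes I g i (ModuleCat.of R M) := by
  induction l generalizing M i with
  | nil =>
    obtain ⟨i, rfl⟩ := Nat.exists_eq_add_of_lt hi
    exact extVanishes_of_forall_torsion hg _ M fun f hf => (hM f hf).resolve_left (by simp)
  | cons f l ih =>
    obtain ⟨i, rfl⟩ : ∃ j, i = j + 1 := ⟨i - 1, by omega⟩
    have hfI := hl f (by simp)
    have hl' : ∀ f ∈ l, f ∈ I := fun h hh => hl h (by simp [hh])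
    rw [List.length_cons] at hi
    refine ExtVanishes.middle (LinearMap.ker (awayMap M f)).injective_subtype
      (v := (awayMap M f).rangeRestrict) ?_ (LinearMap.surjective_rangeRestrict _)
      (ih hl' _ (fun h hh => ?_) _ (by omega)) ?_
    · rw [LinearMap.exact_iff, LinearMap.ker_rangeRestrict, Submodule.range_subtype]
    · obtain hh | hh := hM h hh
      · rw [List.mem_cons] at hh
        obtain rfl | hh := hh
        · exact .inr (isPowTorsion_ker_awayMap h)
        · exact .inl hh
      · exact .inr (hh.submodule _)
    · refine ExtVanishes.left (LinearMap.range (awayMap M f)).injective_subtype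
        (LinearMap.exact_subtype_mkQ _) (Submodule.mkQ_surjective _)
        (ih hl' _ (fun h hh => ?_) _ (by omega))
        (extVanishes_of_bijective hfI _ (bijective_smul_localizedModule f))
      obtain hh | hh := hM h hh
      · rw [List.mem_cons] at hh
        obtain rfl | hh := hh
        · exact .inr (isPowTorsion_awayCoker_self h)
        · exact .inl hh
      · exact .inr (hh.awayCoker _)

/-- The ideal generated by the `c`-th powers of the elements of a list. -/
def powIdeal (l : List R) (c : ℕ) : Ideal R := Ideal.span {y | ∃ f ∈ l, f ^ c = y}

/-- The elements `P ^ b • x` stay outside the submodules generated by `(b + 1)`-st powers, where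
`P` is the product of `l`, even after multiplication by powers of `g`. -/
def IsPowIndep (g : R) (l : List R) (x : M) : Prop :=
  ∀ b r : ℕ, g ^ r • l.prod ^ b • x ∉ powIdeal l (b + 1) • (⊤ : Submodule R M)

lemma prod_pow_smul_mem_powIdeal_smul_top {l l' : List R} (h : ∀ f ∈ l, f ∈ l') {c : ℕ} (e : ℕ)
    {y : M} (hy : y ∈ powIdeal l c • (⊤ : Submodule R M)) :
    l.prod ^ e • y ∈ powIdeal l' (c + e) • (⊤ : Submodule R M) := by
  have hJ : ∀ a ∈ powIdeal l c, l.prod ^ e * a ∈ powIdeal l' (c + e) := by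
    intro a ha
    induction ha using Submodule.span_induction with
    | mem a ha =>
      obtain ⟨f, hf, rfl⟩ := ha
      have hmem : f ^ (c + e) ∈ powIdeal l' (c + e) := Ideal.subset_span ⟨f, h f hf, rfl⟩
      refine Ideal.mem_of_dvd _ ?_ hmem
      rw [pow_add, mul_comm]
      exact mul_dvd_mul (pow_dvd_pow_of_dvd (List.dvd_prod hf) e) dvd_rfl
    | zero => simp
    | add x y _ _ hx hy => rw [mul_add]; exact add_mem hx hy
    | smul r x _ hx => rw [smul_eq_mul, mul_left_comm]; exact Ideal.mul_mem_left _ _ hx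
  induction hy using Submodule.smul_induction_on' with
  | smul a ha m _ => rw [smul_smul]; exact Submodule.smul_mem_smul (hJ a ha) trivial
  | add x _ y _ hx hy => rw [smul_add]; exact add_mem hx hy

lemma exists_pow_smul_eq_of_mkQ_mem {f : R} {J : Ideal R}
    {z : LocalizedModule (Submonoid.powers f) M}
    (hz : (LinearMap.range (awayMap M f)).mkQ z ∈ J • (⊤ : Submodule R (AwayCoker M f))) :
    ∃ (c : ℕ) (y m : M), y ∈ J • (⊤ : Submodule R M) ∧
      f ^ c • z = awayMap M f y + f ^ c • awayMap M f m := by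
  have hmap : J • (⊤ : Submodule R (AwayCoker M f)) =
      (J • ⊤ : Submodule R _).map (LinearMap.range (awayMap M f)).mkQ := by
    rw [Submodule.map_smul'', Submodule.map_top, Submodule.range_mkQ]
  obtain ⟨z', hz', h⟩ := hmap.le hz
  obtain ⟨m, hm⟩ : z - z' ∈ LinearMap.range (awayMap M f) := by
    rw [← Submodule.Quotient.mk_eq_zero, Submodule.Quotient.mk_sub]
    exact sub_eq_zero.2 h.symm
  obtain ⟨c, y, hy, hc⟩ : ∃ (c : ℕ) (y : M), y ∈ J • (⊤ : Submodule R M) ∧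
      f ^ c • z' = awayMap M f y := by
    clear hm h
    induction hz' using Submodule.smul_induction_on' with
    | smul a ha n _ =>
      obtain ⟨c, y, hy⟩ := exists_pow_smul_eq_awayMap f n
      exact ⟨c, a • y, Submodule.smul_mem_smul ha trivial, by rw [smul_comm, hy, map_smul]⟩
    | add x _ y _ hx hy =>
      obtain ⟨c, p, hp, hx⟩ := hx
      obtain ⟨d, q, hq, hy⟩ := hy
      refine ⟨c + d, f ^ d • p + f ^ c • q,
        add_mem (Submodule.smul_mem _ _ hp) (Submodule.smul_mem _ _ hq), ?_⟩
      rw [map_add, map_smul, map_smul, ← hx, ← hy, smul_smul, smul_smul, smul_add, ← pow_add,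
        ← pow_add, add_comm d c]
  refine ⟨c, y, m, hy, ?_⟩
  rw [hm, ← hc, smul_sub]
  abel

lemma IsPowIndep.awayCoker {f : R} {l : List R} {x : M} (hx : IsPowIndep g (f :: l) x) :
    ∃ x' : AwayCoker M f, IsPowIndep g l x' := by
  obtain ⟨w, hw⟩ := (bijective_smul_localizedModule f).surjective (awayMap M f x)
  refine ⟨(LinearMap.range (awayMap M f)).mkQ w, fun b r hb => ?_⟩
  rw [← map_smul, ← map_smul] at hb
  obtain ⟨c, y, m, hy, h⟩ := exists_pow_smul_eq_of_mkQ_mem hb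
  obtain ⟨d, hd⟩ : ∃ d : ℕ, f ^ d • (f ^ c • g ^ r • l.prod ^ b • x -
      (f • y + f ^ (c + 1) • m)) = 0 := by
    refine exists_pow_smul_eq_zero_of_awayMap_eq_zero ?_
    rw [map_sub, sub_eq_zero, map_smul, map_smul, map_smul, ← hw, map_add, map_smul, map_smul,
      pow_succ', mul_smul, ← smul_add, ← h]
    simp only [smul_smul]
    congr 1
    ring
  rw [smul_sub, sub_eq_zero] at hd
  refine hx (b + (d + c)) r ?_
  have key : g ^ r • (f :: l).prod ^ (b + (d + c)) • x =
      (f ^ (b + d + 1)) • l.prod ^ (d + c) • y +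
        f ^ (b + (d + c) + 1) • l.prod ^ (d + c) • m := by
    rw [List.prod_cons]
    have := congrArg (fun z => (l.prod ^ (d + c) * f ^ b) • z) hd
    simp only [smul_add, smul_smul] at this ⊢
    convert this using 1
    · ring_nf
    · congr 1 <;> ring_nf
  rw [key]
  refine add_mem (Submodule.smul_mem _ _ ?_) (Submodule.smul_mem_smul ?_ trivial)
  · convert prod_pow_smul_mem_powIdeal_smul_top (l := l) (l' := f :: l)
      (fun h hh => by simp [hh]) (d + c) hy using 3
    ring
  · exact Ideal.subset_span ⟨f, by simp, rfl⟩

lemma not_extVanishes_length [IsNoetherianRing R] {L : List R}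
    (hg : ∀ x ∈ I, g * x ∈ Ideal.span {f | f ∈ L}) (l : List R) (hl : ∀ f ∈ l, f ∈ I)
    (M : Type) [AddCommGroup M] [Module R M] (hM : ∀ f ∈ L, f ∈ l ∨ IsPowTorsion f M)
    {x : M} (hx : IsPowIndep g l x) : ¬ ExtVanishes I g l.length (ModuleCat.of R M) := by
  induction l generalizing M with
  | nil =>
    intro hV
    have hM' : ∀ f ∈ L, IsPowTorsion f M := fun f hf => (hM f hf).resolve_left (by simp)
    obtain ⟨c, t, ht⟩ := exists_pow_smul_mem_idealPowTorsion hg hM' x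
    let φ : ModuleCat.of R (R ⧸ I ^ t) ⟶ ModuleCat.of R M :=
      ModuleCat.ofHom ((I ^ t).liftQ (LinearMap.toSpanSingleton R M (g ^ c • x)) ht)
    obtain ⟨t', h, r, hr⟩ := hV t (Ext.mk₀ φ)
    rw [Ext.mk₀_comp_mk₀, ← Ext.mk₀_smul] at hr
    have h0 : g ^ r • (quotPowMap I h ≫ φ) = 0 :=
      (Ext.mk₀_bijective _ _).1 (hr.trans (Ext.mk₀_zero _ _).symm)
    have h1 : g ^ r • (1 : R) • g ^ c • x = 0 :=
      congrArg (fun (u : ModuleCat.of R (R ⧸ I ^ t') ⟶ ModuleCat.of R M) =>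
        u (Submodule.Quotient.mk (1 : R))) h0
    refine hx 0 (r + c) ?_
    rw [one_smul, smul_smul, ← pow_add] at h1
    simp [h1]
  | cons f l ih =>
    intro hV
    have hfI := hl f (by simp)
    have hl' : ∀ f ∈ l, f ∈ I := fun h hh => hl h (by simp [hh])
    have hV1 : ExtVanishes I g (l.length + 1) (ModuleCat.of R (LinearMap.range (awayMap M f))) := by
      refine ExtVanishes.right (LinearMap.ker (awayMap M f)).injective_subtype
        (v := (awayMap M f).rangeRestrict) ?_ (LinearMap.surjective_rangeRestrict _) hV
        (extVanishes_of_length_lt hg l hl' _ (fun h hh => ?_) _ (by omega))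
      · rw [LinearMap.exact_iff, LinearMap.ker_rangeRestrict, Submodule.range_subtype]
      · obtain hh | hh := hM h hh
        · rw [List.mem_cons] at hh
          obtain rfl | hh := hh
          · exact .inr (isPowTorsion_ker_awayMap h)
          · exact .inl hh
        · exact .inr (hh.submodule _)
    obtain ⟨x', hx'⟩ := hx.awayCoker
    refine ih hl' (AwayCoker M f) (fun h hh => ?_) hx' 
      (ExtVanishes.right (LinearMap.range (awayMap M f)).injective_subtype
        (LinearMap.exact_subtype_mkQ _) (Submodule.mkQ_surjective _)
        (extVanishes_of_bijective hfI _ (bijective_smul_localizedModule f)) hV1)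
    obtain hh | hh := hM h hh
    · rw [List.mem_cons] at hh
      obtain rfl | hh := hh
      · exact .inr (isPowTorsion_awayCoker_self h)
      · exact .inl hh
    · exact .inr (hh.awayCoker _)

end Nonvanishing

/-- If `g • I` lies in the ideal generated by elements `L` of `I` that are independent in the sense
of `IsPowIndep`, then the local cohomology in degree the length of `L` is nonzero. -/
theorem nontrivial_localCohomology_of_isPowIndep {R : Type} [CommRing R] [IsNoetherianRing R]
    {I : Ideal R} {g : R} {L : List R} (hL : ∀ f ∈ L, f ∈ I)
    (hg : ∀ x ∈ I, g * x ∈ Ideal.span {f | f ∈ L}) {M : Type} [AddCommGroup M] [Module R M]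
    {x : M} (hx : IsPowIndep g L x) {n : ℕ} (hn : L.length = n + 1) :
    Nontrivial ((localCohomology I (n + 1)).obj (ModuleCat.of R M)) := by
  have h := not_extVanishes_length hg L hL M (fun f hf => .inl hf) hx
  rw [hn] at h
  simp only [ExtVanishes, ExtNegligible] at h
  push Not at h
  obtain ⟨t, e, h⟩ := h
  exact nontrivial_localCohomology_of_ext I _ n t e fun t' ht h0 => h t' ht 0 (by
    rw [pow_zero, one_smul]; exact h0)

end LocalCohomology

namespace MvPolynomial

section Pairing

variable {σ B : Type*} [Fintype σ] [CommRing B]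

/-- The bilinear pairing on polynomials for which monomials are orthogonal and the square norm
of a monomial is the product of the factorials of its exponents. -/
noncomputable def fischerPairing : MvPolynomial σ B →ₗ[B] MvPolynomial σ B →ₗ[B] B :=
  (basisMonomials σ B).constr B fun a => ((∏ i, (a i).factorial : ℕ) : B) • lcoeff B a

lemma fischerPairing_monomial (a : σ →₀ ℕ) (c : B) (q : MvPolynomial σ B) :
    fischerPairing (monomial a c) q = c * (((∏ i, (a i).factorial : ℕ) : B) * coeff a q) := by
  have h : fischerPairing (monomial a (1 : B)) = ((∏ i, (a i).factorial : ℕ) : B) • lcoeff B a := by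
    have := Module.Basis.constr_basis (basisMonomials σ B) B
      (fun a => ((∏ i, (a i).factorial : ℕ) : B) • lcoeff B a) a
    rwa [coe_basisMonomials] at this
  rw [← mul_one c, ← smul_eq_mul, ← smul_monomial, map_smul, h]
  simp

lemma fischerPairing_self (p : MvPolynomial σ B) :
    fischerPairing p p =
      ∑ a ∈ p.support, ((∏ i, (a i).factorial : ℕ) : B) * (coeff a p) ^ 2 := by
  conv_lhs => enter [1]; rw [p.as_sum]
  rw [map_sum, LinearMap.sum_apply]
  refine Finset.sum_congr rfl fun a _ => ?_
  rw [fischerPairing_monomial]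
  ring

lemma fischerPairing_self_pos {p : MvPolynomial σ ℤ} (hp : p ≠ 0) : 0 < fischerPairing p p := by
  rw [fischerPairing_self]
  refine Finset.sum_pos (fun a ha => ?_) (support_nonempty.2 hp)
  have h1 : 0 < ∏ i, (a i).factorial := Finset.prod_pos fun i _ => Nat.factorial_pos _
  have h2 := mem_support_iff.1 ha
  positivity

lemma fischerPairing_map {B' : Type*} [CommRing B'] (f : B →+* B') (p q : MvPolynomial σ B) :
    fischerPairing (map f p) (map f q) = f (fischerPairing p q) := by
  induction p using MvPolynomial.induction_on' with
  | monomial a c => simp [fischerPairing_monomial, coeff_map]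
  | add p p' h h' => simp [h, h']

variable [DecidableEq σ]

lemma fischerPairing_X_mul (i : σ) (p q : MvPolynomial σ B) :
    fischerPairing (X i * p) q = fischerPairing p (pderiv i q) := by
  induction p using MvPolynomial.induction_on' with
  | add p p' h h' => simp [mul_add, h, h']
  | monomial a c =>
    have : X i * monomial a c = monomial (a + Finsupp.single i 1) c := by
      rw [mul_comm, monomial_add_single, pow_one]
    rw [this, fischerPairing_monomial, fischerPairing_monomial, coeff_pderiv]
    have h : ∏ j, ((a + Finsupp.single i 1 : σ →₀ ℕ) j).factorial =
        (a i + 1) * ∏ j, (a j).factorial := by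
      rw [← Finset.mul_prod_erase _ _ (Finset.mem_univ i),
        ← Finset.mul_prod_erase _ (fun j => (a j).factorial) (Finset.mem_univ i), ← mul_assoc]
      congr 1
      · simp [Nat.factorial_succ]
      · refine Finset.prod_congr rfl fun j hj => ?_
        simp [(Finset.ne_of_mem_erase hj).symm]
    rw [h]
    push_cast
    ring

/-- The linear substitution given by a matrix. -/
noncomputable def linearSubst (M : Matrix σ σ B) : MvPolynomial σ B →ₐ[B] MvPolynomial σ B :=
  aeval fun i => ∑ k, C (M i k) * X k

omit [DecidableEq σ] in
lemma linearSubst_X (M : Matrix σ σ B) (i : σ) :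
    linearSubst M (X i) = ∑ k, C (M i k) * X k := by
  simp [linearSubst]

lemma pderiv_linearSubst (M : Matrix σ σ B) (i : σ) (q : MvPolynomial σ B) :
    pderiv i (linearSubst M q) = ∑ k, C (M k i) * linearSubst M (pderiv k q) := by
  induction q using MvPolynomial.induction_on with
  | C c => simp [linearSubst]
  | add p q hp hq => simp [hp, hq, mul_add, Finset.sum_add_distrib]
  | mul_X p j hp =>
    rw [map_mul, pderiv_mul, hp, linearSubst_X]
    simp only [pderiv_mul, map_add, map_mul, mul_add, Finset.sum_add_distrib, map_sum,
      pderiv_X, pderiv_C, zero_mul, zero_add, linearSubst_X]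
    congr 1
    · rw [Finset.sum_mul]
      exact Finset.sum_congr rfl fun k _ => by ring
    · simp [Pi.single_apply, Finset.sum_ite_eq, mul_comm, apply_ite]

omit [DecidableEq σ] in
lemma coeff_zero_linearSubst (M : Matrix σ σ B) (q : MvPolynomial σ B) :
    coeff 0 (linearSubst M q) = coeff 0 q := by
  rw [← constantCoeff_eq]
  induction q using MvPolynomial.induction_on with
  | C c => simp [linearSubst]
  | add p q hp hq => simp [hp, hq]
  | mul_X p j hp => simp [linearSubst_X]

lemma fischerPairing_linearSubst (M : Matrix σ σ B) (p q : MvPolynomial σ B) :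
    fischerPairing (linearSubst M p) q = fischerPairing p (linearSubst M.transpose q) := by
  induction p using MvPolynomial.induction_on generalizing q with
  | C c =>
    have : linearSubst M (C c) = monomial 0 c := by simp [linearSubst]
    rw [this, C_apply, fischerPairing_monomial, fischerPairing_monomial, coeff_zero_linearSubst]
  | add p p' h h' => simp [h, h']
  | mul_X p j hp =>
    rw [map_mul, mul_comm p, fischerPairing_X_mul, pderiv_linearSubst, linearSubst_X,
      Finset.mul_sum, map_sum, map_sum, LinearMap.sum_apply]
    refine Finset.sum_congr rfl fun k _ => ?_
    rw [mul_comm, mul_assoc, ← smul_eq_C_mul, map_smul, LinearMap.smul_apply, fischerPairing_X_mul,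
      hp, ← smul_eq_C_mul, map_smul]
    rfl

end Pairing

section DetFunctional

open Matrix

/-- The functional `⟨det ^ w, ·⟩` on polynomials in the entries of a generic matrix. -/
noncomputable def detFunctional (N w : ℕ) (B : Type*) [CommRing B] :
    MvPolynomial (Fin N × Fin N) B →ₗ[B] B :=
  fischerPairing ((mvPolynomialX (Fin N) (Fin N) B).det ^ w)

variable {N w : ℕ} {B : Type*} [CommRing B]

lemma linearSubst_kronecker_one_X (A : Matrix (Fin N) (Fin N) B) (i j : Fin N) :
    linearSubst (kronecker A 1) (X (i, j)) = ∑ k, C (A i k) * X (k, j) := by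
  rw [linearSubst_X, Fintype.sum_prod_type]
  refine Finset.sum_congr rfl fun k _ => ?_
  simp [kronecker, kroneckerMap_apply, one_apply, apply_ite]

lemma linearSubst_kronecker_one_det (A : Matrix (Fin N) (Fin N) B) :
    linearSubst (kronecker A 1) (mvPolynomialX (Fin N) (Fin N) B).det =
      C A.det * (mvPolynomialX (Fin N) (Fin N) B).det := by
  rw [AlgHom.map_det, RingHom.map_det, ← det_mul]
  congr 1
  ext1 i j
  simp only [AlgHom.mapMatrix_apply, RingHom.mapMatrix_apply, map_apply, mvPolynomialX_apply,
    mul_apply]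
  exact linearSubst_kronecker_one_X A i j

lemma detFunctional_linearSubst (A : Matrix (Fin N) (Fin N) B)
    (h : MvPolynomial (Fin N × Fin N) B) :
    detFunctional N w B (linearSubst (kronecker A 1) h) = A.det ^ w * detFunctional N w B h := by
  have hT : kronecker A 1 = (kronecker Aᵀ (1 : Matrix (Fin N) (Fin N) B))ᵀ := by
    rw [kronecker, ← kroneckerMap_transpose, transpose_transpose, transpose_one]
  rw [detFunctional, hT, ← fischerPairing_linearSubst, map_pow, linearSubst_kronecker_one_det,
    mul_pow, ← C_pow, ← smul_eq_C_mul, map_smul, det_transpose]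
  rfl

lemma map_det_mvPolynomialX {B' : Type*} [CommRing B'] (f : B →+* B') :
    map f (mvPolynomialX (Fin N) (Fin N) B).det = (mvPolynomialX (Fin N) (Fin N) B').det := by
  rw [RingHom.map_det]
  congr 1
  ext1 i j
  simp

lemma detFunctional_map {B' : Type*} [CommRing B'] (f : B →+* B')
    (h : MvPolynomial (Fin N × Fin N) B) :
    detFunctional N w B' (map f h) = f (detFunctional N w B h) := by
  rw [detFunctional, ← map_det_mvPolynomialX f, ← map_pow, fischerPairing_map, detFunctional]

lemma exists_detFunctional_det_pow_eq (N w : ℕ) :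
    ∃ k : ℤ, k ≠ 0 ∧ ∀ (B : Type) [CommRing B],
      detFunctional N w B ((mvPolynomialX (Fin N) (Fin N) B).det ^ w) = k := by
  refine ⟨detFunctional N w ℤ ((mvPolynomialX (Fin N) (Fin N) ℤ).det ^ w),
    (fischerPairing_self_pos (pow_ne_zero _ (det_mvPolynomialX_ne_zero _ _))).ne', fun B _ => ?_⟩
  rw [← map_det_mvPolynomialX (Int.castRingHom B), ← map_pow, detFunctional_map]
  rfl

end DetFunctional

section GenericRow

open Matrix

variable {N : ℕ} {K : Type} [Field K]

variable (K) in
/-- The `j`-th entry of the product of a generic row vector with a generic matrix. -/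
noncomputable def genericRowMul (j : Fin N) :
    MvPolynomial (Fin N × Fin N) (MvPolynomial (Fin N) K) :=
  ∑ i, C (X i) * X (i, j)

variable (K N) in
/-- The homomorphism whose image is generated by the entries of a generic matrix and the entries
of the product of a generic row vector with it. -/
noncomputable def genericRowHom :
    MvPolynomial (Fin N) (MvPolynomial (Fin N × Fin N) K) →+*
      MvPolynomial (Fin N × Fin N) (MvPolynomial (Fin N) K) :=
  eval₂Hom (map C) (genericRowMul K)

lemma detFunctional_mul_eq_zero (w : ℕ) (p : MvPolynomial (Fin (N + 1) × Fin (N + 1)) K)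
    (α : Fin (N + 1) → ℕ) (hα : w < ∑ j, α j) :
    detFunctional (N + 1) w _ (map C p * ∏ j, genericRowMul K j ^ α j) = 0 := by
  set h := map C p * ∏ j, genericRowMul K j ^ α j
  let ι : MvPolynomial (Fin (N + 1)) K →+* Polynomial (MvPolynomial (Fin (N + 1)) K) :=
    Polynomial.C
  let A : Matrix (Fin (N + 1)) (Fin (N + 1)) (Polynomial (MvPolynomial (Fin (N + 1)) K)) :=
    Matrix.of fun i k => if i = k then (if i = 0 then Polynomial.X else ι (X 0)) else
      if i = 0 then - ι (X k) else 0
  have hdet : A.det = Polynomial.X * ι (X 0) ^ N := by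
    rw [det_of_isUpperTriangular, Fin.prod_univ_succ]
    · simp [A, Fin.succ_ne_zero]
    · intro i j hij
      have h1 : i ≠ j := ne_of_gt hij
      have h2 : i ≠ 0 := fun h0 => by subst h0; exact absurd hij (Fin.not_lt_zero _)
      simp [A, h1, h2]
  have hrow : ∀ k, ∑ i, ι (X i) * A i k = if k = 0 then Polynomial.X * ι (X 0) else 0 := by
    intro k
    rw [Fin.sum_univ_succ]
    by_cases hk : k = 0
    · subst hk
      simp [A, Fin.succ_ne_zero, mul_comm]
    · obtain ⟨k, rfl⟩ := Fin.exists_succ_eq.2 hk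
      simp [A, Fin.succ_ne_zero, (Fin.succ_ne_zero _).symm, mul_comm]
      ring
  have hy : ∀ j, linearSubst (kronecker A 1) (map ι (genericRowMul K j)) =
      C (Polynomial.X * ι (X 0)) * X (0, j) := by
    intro j
    simp only [genericRowMul, map_sum, map_mul, map_C, map_X, linearSubst_kronecker_one_X]
    simp only [linearSubst, algHom_C, algebraMap_eq, Finset.mul_sum]
    rw [Finset.sum_comm]
    simp only [← mul_assoc, ← map_mul, ← Finset.sum_mul, ← map_sum, hrow]
    simp [apply_ite C, ite_mul]
  have key : (Polynomial.X * ι (X 0) ^ N) ^ w * ι (detFunctional (N + 1) w _ h) =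
      Polynomial.X ^ (∑ j, α j) * detFunctional (N + 1) w _
        (linearSubst (kronecker A 1) (map ι (map C p)) * ∏ j, (C (ι (X 0)) * X (0, j)) ^ α j) := by
    rw [← detFunctional_map, ← hdet, ← detFunctional_linearSubst, ← smul_eq_mul, ← map_smul,
      smul_eq_C_mul]
    congr 1
    simp only [h, map_mul, map_prod, map_pow, hy, mul_pow, Finset.prod_mul_distrib,
      Finset.prod_pow_eq_pow_sum]
    ring
  obtain ⟨d, hd⟩ := Nat.exists_eq_add_of_lt hα
  rw [hd, show w + d + 1 = w + (d + 1) by omega, pow_add, mul_pow, mul_assoc, mul_assoc] at key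
  have key' := mul_left_cancel₀ (pow_ne_zero w Polynomial.X_ne_zero) key
  have key'' := congrArg (Polynomial.eval 0) key'
  simpa [ι] using key''

/-- Every coefficient of `h` has total degree at most `d`. -/
def CoeffDegreeLE {σ τ : Type} (d : ℕ) (h : MvPolynomial σ (MvPolynomial τ K)) : Prop :=
  ∀ a, (coeff a h).totalDegree ≤ d

lemma CoeffDegreeLE.mul {σ τ : Type} [DecidableEq σ] {d e : ℕ}
    {h h' : MvPolynomial σ (MvPolynomial τ K)}
    (hd : CoeffDegreeLE d h) (he : CoeffDegreeLE e h') : CoeffDegreeLE (d + e) (h * h') := by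
  intro a
  rw [coeff_mul]
  exact totalDegree_finsetSum_le fun x _ =>
    (totalDegree_mul _ _).trans (add_le_add (hd _) (he _))

lemma CoeffDegreeLE.map_C {σ τ : Type} (p : MvPolynomial σ K) :
    CoeffDegreeLE 0 (map (C (σ := τ)) p) := fun a => by
  simp [coeff_map]

lemma CoeffDegreeLE.pow {σ τ : Type} [DecidableEq σ] {d : ℕ}
    {h : MvPolynomial σ (MvPolynomial τ K)}
    (hd : CoeffDegreeLE d h) (n : ℕ) : CoeffDegreeLE (n * d) (h ^ n) := by
  induction n with
  | zero => simpa using CoeffDegreeLE.map_C (1 : MvPolynomial σ K)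
  | succ n ih => rw [pow_succ, Nat.succ_mul]; exact ih.mul hd

lemma CoeffDegreeLE.prod {σ τ ι : Type} [DecidableEq σ] (s : Finset ι) {d : ι → ℕ}
    {h : ι → MvPolynomial σ (MvPolynomial τ K)} (hd : ∀ i, CoeffDegreeLE (d i) (h i)) :
    CoeffDegreeLE (∑ i ∈ s, d i) (∏ i ∈ s, h i) := by
  classical
  induction s using Finset.induction_on with
  | empty => simpa using CoeffDegreeLE.map_C (1 : MvPolynomial σ K)
  | insert i s hi ih => rw [Finset.sum_insert hi, Finset.prod_insert hi]; exact (hd i).mul ih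

lemma coeffDegreeLE_genericRowMul (j : Fin N) : CoeffDegreeLE 1 (genericRowMul K j) := by
  intro a
  rw [genericRowMul, coeff_sum]
  refine totalDegree_finsetSum_le fun i _ => ?_
  rw [coeff_C_mul, coeff_X]
  split_ifs <;> simp

lemma totalDegree_fischerPairing_le {σ τ : Type} [Fintype σ] {d : ℕ} (p : MvPolynomial σ K)
    {h : MvPolynomial σ (MvPolynomial τ K)} (hd : CoeffDegreeLE d h) :
    (fischerPairing (map C p) h).totalDegree ≤ d := by
  induction p using MvPolynomial.induction_on' with
  | add p q hp hq =>
    rw [map_add, map_add, LinearMap.add_apply]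
    exact (totalDegree_add _ _).trans (max_le hp hq)
  | monomial a c =>
    rw [map_monomial, fischerPairing_monomial, ← map_natCast (C (σ := τ) (R := K))]
    refine (totalDegree_mul _ _).trans ?_
    rw [totalDegree_C, zero_add]
    refine (totalDegree_mul _ _).trans ?_
    rw [totalDegree_C, zero_add]
    exact hd a

lemma totalDegree_detFunctional_genericRowHom_le (w : ℕ)
    (G : MvPolynomial (Fin (N + 1)) (MvPolynomial (Fin (N + 1) × Fin (N + 1)) K)) :
    (detFunctional (N + 1) w _ (genericRowHom (N + 1) K G)).totalDegree ≤ w := by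
  rw [genericRowHom, coe_eval₂Hom, eval₂_eq', map_sum]
  refine totalDegree_finsetSum_le fun α _ => ?_
  by_cases hα : w < ∑ j, α j
  · rw [detFunctional_mul_eq_zero w _ _ hα]
    simp
  · rw [detFunctional, ← map_det_mvPolynomialX (C (σ := Fin (N + 1)) (R := K)), ← map_pow]
    refine (totalDegree_fischerPairing_le _ (CoeffDegreeLE.mul (.map_C _)
      (CoeffDegreeLE.prod _ fun j => (coeffDegreeLE_genericRowMul j).pow (α j)))).trans ?_
    simpa using hα

/-- A power of the generic determinant times a monomial in the generic row vector is not in the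
subring generated by the entries of the matrix and of the product of the row vector with the
matrix, modulo higher powers of the entries of the row vector. -/
theorem det_pow_mul_prod_pow_ne [CharZero K] {t w : ℕ} (hw : w < N * t) {c : K} (hc : c ≠ 0)
    (b : Fin N → MvPolynomial (Fin N × Fin N) (MvPolynomial (Fin N) K))
    (G : MvPolynomial (Fin N) (MvPolynomial (Fin N × Fin N) K)) :
    C (C c * ∏ j, X j ^ t) * (mvPolynomialX (Fin N) (Fin N) _).det ^ w ≠
      ∑ j, C (X j ^ (t + 1)) * b j + genericRowHom N K G := by
  obtain _ | N := N
  · simp at hw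
  intro heq
  obtain ⟨k, hk, hk'⟩ := exists_detFunctional_det_pow_eq (N + 1) w
  have h1 := congrArg (detFunctional (N + 1) w _) heq
  simp only [← smul_eq_C_mul, map_add, map_sum, map_smul, hk'] at h1
  let m : Fin (N + 1) →₀ ℕ := Finsupp.equivFunOnFinite.symm fun _ => t
  have h2 := congrArg (coeff m) h1
  have hm : ∏ j, X j ^ t = monomial (R := K) m 1 := by
    rw [monomial_eq, C_1, one_mul, Finsupp.prod_fintype _ _ fun i => pow_zero _]
    simp [m]
  have hG : coeff m (detFunctional (N + 1) w _ (genericRowHom (N + 1) K G)) = 0 := by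
    refine coeff_eq_zero_of_totalDegree_lt
      ((totalDegree_detFunctional_genericRowHom_le w G).trans_lt ?_)
    rw [← Finsupp.degree_apply, Finsupp.degree_eq_sum]
    simpa [m] using hw
  rw [coeff_add, coeff_sum, Finset.sum_eq_zero, zero_add, hG, hm, ← map_intCast
    (C (σ := Fin (N + 1)) (R := K)), smul_eq_mul, mul_comm, coeff_C_mul, coeff_smul,
    coeff_monomial, if_pos rfl] at h2
  · have hk0 : (k : K) ≠ 0 := Int.cast_ne_zero.2 hk
    exact mul_ne_zero hk0 (mul_ne_zero hc one_ne_zero) h2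
  · intro j _
    rw [smul_eq_mul, X_pow_eq_monomial, coeff_monomial_mul', if_neg]
    intro hle
    have := hle j
    simp [m] at this

end GenericRow

end MvPolynomial

namespace Matrix

section PfaffianSum

open Equiv

variable {R : Type*} [CommRing R] {n : ℕ}

/-- Pairs of consecutive indices. -/
def pairEquiv (n : ℕ) : Fin n × Fin 2 ≃ Fin (2 * n) :=
  finProdFinEquiv.trans (finCongr (mul_comm n 2))

lemma pairEquiv_zero_val (i : Fin n) : (pairEquiv n (i, 0) : ℕ) = 2 * i := by
  simp [pairEquiv]

lemma pairEquiv_one_val (i : Fin n) : (pairEquiv n (i, 1) : ℕ) = 2 * i + 1 := by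
  simp [pairEquiv, add_comm]

/-- The sum over all permutations in the definition of the Pfaffian; for skew-symmetric matrices
it is `2 ^ n * n !` times the Pfaffian. -/
def pfaffianSum (A : Matrix (Fin (2 * n)) (Fin (2 * n)) R) : R :=
  ∑ σ : Perm (Fin (2 * n)), (Perm.sign σ : ℤ) •
    ∏ i : Fin n, A (σ (pairEquiv n (i, 0))) (σ (pairEquiv n (i, 1)))

lemma map_pfaffianSum {R' : Type*} [CommRing R'] (f : R →+* R')
    (A : Matrix (Fin (2 * n)) (Fin (2 * n)) R) :
    f (pfaffianSum A) = pfaffianSum (A.map f) := by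
  simp [pfaffianSum, map_sum, map_prod]

lemma prod_pairEquiv (f : Fin (2 * n) → R) :
    ∏ a, f a = ∏ i, f (pairEquiv n (i, 0)) * f (pairEquiv n (i, 1)) := by
  rw [← (pairEquiv n).prod_comp, Fintype.prod_prod_type]
  simp [Fin.prod_univ_two]

lemma det_submatrix_id_of_not_bijective (Y : Matrix (Fin n) (Fin n) R) (φ : Fin n → Fin n)
    (h : ¬ Function.Bijective φ) : (Y.submatrix id φ).det = 0 := by
  rw [← Finite.injective_iff_bijective] at h
  simp only [Function.Injective, not_forall] at h
  obtain ⟨a, b, hab, hne⟩ := h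
  exact det_zero_of_column_eq hne fun k => by simp [hab]

/-- Pfaffians transform under congruence by the determinant. -/
lemma pfaffianSum_congruence (Y B : Matrix (Fin (2 * n)) (Fin (2 * n)) R) :
    pfaffianSum (Y * B * Yᵀ) = Y.det * pfaffianSum B := by
  let w (φ : Fin (2 * n) → Fin (2 * n)) : R :=
    ∏ i : Fin n, B (φ (pairEquiv n (i, 0))) (φ (pairEquiv n (i, 1)))
  let E : (Fin (2 * n) → Fin (2 * n)) ≃ (Fin n → Fin (2 * n) × Fin (2 * n)) :=
    ((pairEquiv n).symm.arrowCongr (Equiv.refl _)).trans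
      ((Equiv.curry _ _ _).trans (Equiv.arrowCongr (Equiv.refl _) (finTwoArrowEquiv _)))
  have h1 (σ : Perm (Fin (2 * n))) :
      ∏ i : Fin n, (Y * B * Yᵀ) (σ (pairEquiv n (i, 0))) (σ (pairEquiv n (i, 1))) =
        ∑ φ, w φ * ∏ a, (Y.submatrix id φ) (σ a) a := by
    have h2 (a b : Fin (2 * n)) : (Y * B * Yᵀ) a b =
        ∑ p : Fin (2 * n) × Fin (2 * n), B p.1 p.2 * (Y a p.1 * Y b p.2) := by
      simp only [mul_apply, transpose_apply, Finset.sum_mul]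
      rw [Finset.sum_comm, Fintype.sum_prod_type]
      exact Finset.sum_congr rfl fun c _ => Finset.sum_congr rfl fun d _ => by ring
    simp only [h2]
    rw [Finset.prod_univ_sum, Fintype.piFinset_univ, ← E.sum_comp]
    refine Finset.sum_congr rfl fun φ _ => ?_
    rw [Finset.prod_mul_distrib, prod_pairEquiv]
    rfl
  have h3 : pfaffianSum (Y * B * Yᵀ) = ∑ φ, w φ * (Y.submatrix id φ).det := by
    simp only [pfaffianSum, h1, det_apply, Finset.smul_sum, Finset.mul_sum]
    rw [Finset.sum_comm]
    refine Finset.sum_congr rfl fun φ _ => Finset.sum_congr rfl fun σ _ => ?_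
    rw [Units.smul_def, mul_smul_comm]
  rw [h3, pfaffianSum, Finset.mul_sum]
  refine (Fintype.sum_of_injective (fun σ : Perm (Fin (2 * n)) => (σ : Fin (2 * n) → Fin (2 * n)))
    DFunLike.coe_injective _ _ (fun φ hφ => ?_) fun σ => ?_).symm
  · rw [det_submatrix_id_of_not_bijective, mul_zero]
    exact fun hb => hφ ⟨Equiv.ofBijective φ hb, rfl⟩
  · rw [det_permute', zsmul_eq_mul]
    simp only [w]
    ring

variable (n R) in
/-- The standard alternating matrix. -/
def standardAlternating : Matrix (Fin (2 * n)) (Fin (2 * n)) R :=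
  (kroneckerMap (· * ·) (1 : Matrix (Fin n) (Fin n) R) !![0, 1; -1, 0]).submatrix
    (pairEquiv n).symm (pairEquiv n).symm

lemma standardAlternating_pairEquiv (p q : Fin n × Fin 2) :
    standardAlternating R n (pairEquiv n p) (pairEquiv n q) =
      if p.1 = q.1 then (!![0, 1; -1, 0] : Matrix (Fin 2) (Fin 2) R) p.2 q.2 else 0 := by
  simp [standardAlternating, one_apply]

lemma det_standardAlternating : (standardAlternating R n).det = 1 := by
  rw [standardAlternating, det_submatrix_equiv_self]
  refine (det_kronecker (1 : Matrix (Fin n) (Fin n) R) !![0, 1; -1, 0]).trans ?_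
  simp

lemma transpose_standardAlternating :
    (standardAlternating R n)ᵀ = -standardAlternating R n := by
  ext a b
  obtain ⟨⟨i, x⟩, rfl⟩ := (pairEquiv n).surjective a
  obtain ⟨⟨j, y⟩, rfl⟩ := (pairEquiv n).surjective b
  rw [transpose_apply, neg_apply, standardAlternating_pairEquiv, standardAlternating_pairEquiv]
  by_cases h : i = j
  · subst h
    fin_cases x <;> fin_cases y <;> simp
  · simp [h, Ne.symm h]

lemma sign_smul_prod_standardAlternating (σ : Perm (Fin (2 * n))) :
    (Perm.sign σ : ℤ) • ∏ i : Fin n,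
      standardAlternating ℤ n (σ (pairEquiv n (i, 0))) (σ (pairEquiv n (i, 1))) = 0 ∨
    (Perm.sign σ : ℤ) • ∏ i : Fin n,
      standardAlternating ℤ n (σ (pairEquiv n (i, 0))) (σ (pairEquiv n (i, 1))) = 1 := by
  let τ : Perm (Fin n × Fin 2) := (pairEquiv n).symm.permCongr σ
  have hτ (p) : σ (pairEquiv n p) = pairEquiv n (τ p) := by simp [τ]
  have hs : Perm.sign σ = Perm.sign τ := (Perm.sign_permCongr _ _).symm
  simp only [hτ, hs, standardAlternating_pairEquiv]
  by_cases h : ∀ i, (τ (i, 0)).1 = (τ (i, 1)).1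
  · right
    have h' (i x) : (τ (i, x)).1 = (τ (i, 0)).1 := by
      fin_cases x
      · rfl
      · exact (h i).symm
    have hc (i) : Function.Injective fun x => (τ (i, x)).2 := fun x y hxy => by
      have : τ (i, x) = τ (i, y) := Prod.ext ((h' i x).trans (h' i y).symm) hxy
      simpa using τ.injective this
    let c (i) : Perm (Fin 2) := Equiv.ofBijective _ (Finite.injective_iff_bijective.1 (hc i))
    have hπ : Function.Injective fun i => (τ (i, 0)).1 := fun i j hij => by
      obtain ⟨x, hx⟩ := (c j).surjective (c i 0)
      have : τ (i, 0) = τ (j, x) := Prod.ext (hij.trans (h' j x).symm) hx.symm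
      simpa using congrArg Prod.fst (τ.injective this)
    let π : Perm (Fin n) := Equiv.ofBijective _ (Finite.injective_iff_bijective.1 hπ)
    have hfac : τ = prodCongrLeft (fun _ : Fin 2 => π) * prodCongrRight c := by
      ext1 ⟨i, x⟩
      exact Prod.ext (h' i x) rfl
    have hsign : Perm.sign τ = ∏ i, Perm.sign (c i) := by
      rw [hfac, map_mul, Perm.sign_prodCongrLeft, Perm.sign_prodCongrRight]
      simp
    have hentry (i) : (!![0, 1; -1, 0] : Matrix (Fin 2) (Fin 2) ℤ) (τ (i, 0)).2 (τ (i, 1)).2 =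
        Perm.sign (c i) := by
      have (e : Perm (Fin 2)) :
          (!![0, 1; -1, 0] : Matrix (Fin 2) (Fin 2) ℤ) (e 0) (e 1) = Perm.sign e := by
        revert e; decide
      exact this (c i)
    simp only [h, if_true, hentry, hsign, smul_eq_mul]
    rw [Units.coe_prod, ← Finset.prod_mul_distrib]
    exact Finset.prod_eq_one fun i _ => by
      rw [← Units.val_mul, Int.units_mul_self, Units.val_one]
  · left
    push Not at h
    obtain ⟨i, hi⟩ := h
    rw [Finset.prod_eq_zero (Finset.mem_univ i) (if_neg hi), smul_zero]

lemma pfaffianSum_standardAlternating_pos : 0 < pfaffianSum (standardAlternating ℤ n) := by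
  rw [pfaffianSum]
  refine Finset.sum_pos' (fun σ _ => ?_) ⟨1, Finset.mem_univ _, ?_⟩
  · rcases sign_smul_prod_standardAlternating σ with h | h <;> rw [h]
    exact zero_le_one
  · simp [standardAlternating_pairEquiv]

lemma pfaffianSum_standardAlternating :
    pfaffianSum (standardAlternating R n) = (pfaffianSum (standardAlternating ℤ n) : ℤ) := by
  have h : standardAlternating R n = (standardAlternating ℤ n).map (Int.castRingHom R) := by
    ext a b
    obtain ⟨⟨i, x⟩, rfl⟩ := (pairEquiv n).surjective a
    obtain ⟨⟨j, y⟩, rfl⟩ := (pairEquiv n).surjective b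
    rw [map_apply, standardAlternating_pairEquiv, standardAlternating_pairEquiv]
    by_cases hij : i = j
    · fin_cases x <;> fin_cases y <;> simp [hij]
    · simp [hij]
  rw [h, ← map_pfaffianSum]
  rfl

end PfaffianSum

section PfaffianRelation

open Equiv

/-- The permutation sending `0` to `k` and acting as `σ` on the remaining indices. -/
def insertPerm {m : ℕ} (p : Fin (m + 1) × Perm (Fin m)) : Perm (Fin (m + 1)) :=
  p.1.cycleRange.symm * Perm.decomposeFin.symm (0, p.2)

lemma insertPerm_zero {m : ℕ} (p : Fin (m + 1) × Perm (Fin m)) : insertPerm p 0 = p.1 := by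
  simp [insertPerm]

lemma insertPerm_succ {m : ℕ} (p : Fin (m + 1) × Perm (Fin m)) (x : Fin m) :
    insertPerm p x.succ = p.1.succAbove (p.2 x) := by
  simp [insertPerm]

lemma sign_insertPerm {m : ℕ} (p : Fin (m + 1) × Perm (Fin m)) :
    (Perm.sign (insertPerm p) : ℤ) = (-1) ^ (p.1 : ℕ) * Perm.sign p.2 := by
  simp [insertPerm]

lemma insertPerm_bijective (m : ℕ) : Function.Bijective (insertPerm (m := m)) := by
  rw [Fintype.bijective_iff_injective_and_card]
  refine ⟨fun p q h => ?_, by simp [Fintype.card_perm, Nat.factorial_succ]⟩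
  have h1 : p.1 = q.1 := by rw [← insertPerm_zero p, h, insertPerm_zero]
  refine Prod.ext h1 (Equiv.ext fun x => ?_)
  have h2 := insertPerm_succ p x
  rw [h, insertPerm_succ, h1] at h2
  exact (Fin.succAbove_right_injective h2).symm

/-- The other index of the pair of an index, fixing `0`. -/
def partner {n : ℕ} : Fin (2 * n + 1) → Fin (2 * n + 1) :=
  Fin.cases 0 fun a => (pairEquiv n (((pairEquiv n).symm a).1, ((pairEquiv n).symm a).2 + 1)).succ

lemma partner_zero {n : ℕ} : partner (0 : Fin (2 * n + 1)) = 0 := rfl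

lemma partner_pair {n : ℕ} (i : Fin n) (x : Fin 2) :
    partner (pairEquiv n (i, x)).succ = (pairEquiv n (i, x + 1)).succ := by
  simp [partner]

variable {R : Type*} [CommRing R] {n : ℕ} (A : Matrix (Fin (2 * n + 1)) (Fin (2 * n + 1)) R)
  (j : Fin (2 * n + 1))

/-- The summand in the expansion of a linear relation among the sub-maximal Pfaffians. -/
def relationTerm (τ : Perm (Fin (2 * n + 1))) : R :=
  (Perm.sign τ : ℤ) • (A j (τ 0) *
    ∏ i : Fin n, A (τ (pairEquiv n (i, 0)).succ) (τ (pairEquiv n (i, 1)).succ))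

variable (hA : ∀ a b, A a b = -A b a) (hA0 : ∀ a, A a a = 0)

include hA in
lemma relationTerm_swap {τ : Perm (Fin (2 * n + 1))} {i : Fin n} {x : Fin 2}
    (hj : τ (pairEquiv n (i, x)).succ = j) :
    relationTerm A j (τ * Equiv.swap 0 (pairEquiv n (i, x + 1)).succ) = -relationTerm A j τ := by
  set b := (pairEquiv n (i, x + 1)).succ
  have hne {k : Fin n} {y : Fin 2} (h : (k, y) ≠ (i, x + 1)) :
      Equiv.swap 0 b (pairEquiv n (k, y)).succ = (pairEquiv n (k, y)).succ :=
    swap_apply_of_ne_of_ne (Fin.succ_ne_zero _) fun e =>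
      h ((pairEquiv n).injective (Fin.succ_injective _ e))
  have hb : (0 : Fin (2 * n + 1)) ≠ b := (Fin.succ_ne_zero _).symm
  rw [relationTerm, relationTerm, Perm.sign_mul, Perm.sign_swap hb]
  simp only [Perm.coe_mul, Function.comp_apply, swap_apply_left]
  rw [← Finset.mul_prod_erase _ _ (Finset.mem_univ i),
    ← Finset.mul_prod_erase _ (fun i => A (τ (pairEquiv n (i, 0)).succ) _) (Finset.mem_univ i),
    Finset.prod_congr rfl fun k hk => by
      rw [hne fun e => Finset.ne_of_mem_erase hk (congrArg Prod.fst e),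
        hne fun e => Finset.ne_of_mem_erase hk (congrArg Prod.fst e)]]
  have key : A j (τ b) * A (τ (Equiv.swap 0 b (pairEquiv n (i, 0)).succ))
        (τ (Equiv.swap 0 b (pairEquiv n (i, 1)).succ)) =
      A j (τ 0) * A (τ (pairEquiv n (i, 0)).succ) (τ (pairEquiv n (i, 1)).succ) := by
    fin_cases x
    · have hb' : b = (pairEquiv n (i, 1)).succ := rfl
      have hj' : τ (pairEquiv n (i, 0)).succ = j := hj
      rw [hne (by simp), ← hb', swap_apply_right, hj']
      ring
    · have hb' : b = (pairEquiv n (i, 0)).succ := rfl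
      have hj' : τ (pairEquiv n (i, 1)).succ = j := hj
      rw [hne (y := 1) (by simp), ← hb', swap_apply_right, hj', hA (τ 0), hA (τ b)]
      ring
  rw [← mul_assoc, key]
  simp [mul_assoc]

include hA hA0 in
lemma sum_relationTerm : ∑ τ, relationTerm A j τ = 0 := by
  have hcase (τ : Perm (Fin (2 * n + 1))) :
      τ 0 = j ∨ ∃ i x, τ (pairEquiv n (i, x)).succ = j := by
    obtain ⟨a, rfl⟩ := τ.surjective j
    induction a using Fin.cases with
    | zero => exact Or.inl rfl
    | succ a =>
      obtain ⟨⟨i, x⟩, rfl⟩ := (pairEquiv n).surjective a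
      exact Or.inr ⟨i, x, rfl⟩
  have h0 {τ : Perm (Fin (2 * n + 1))} (h : τ 0 = j) : relationTerm A j τ = 0 := by
    simp [relationTerm, h, hA0]
  refine Finset.sum_involution (fun τ _ => τ * Equiv.swap 0 (partner (τ⁻¹ j))) (fun τ _ => ?_)
    (fun τ _ hτ => ?_) (fun _ _ => Finset.mem_univ _) fun τ _ => ?_
  · rcases hcase τ with h | ⟨i, x, h⟩
    · rw [← Perm.eq_inv_iff_eq.2 h, partner_zero, swap_self, h0 h, ← Perm.one_def, mul_one, h0 h,
        add_zero]
    · rw [← Perm.eq_inv_iff_eq.2 h, partner_pair, relationTerm_swap A j hA h, add_neg_cancel]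
  · rcases hcase τ with h | ⟨i, x, h⟩
    · exact absurd (h0 h) hτ
    · rw [← Perm.eq_inv_iff_eq.2 h, partner_pair, Ne, mul_eq_left, swap_eq_one_iff]
      exact (Fin.succ_ne_zero _).symm
  · rcases hcase τ with h | ⟨i, x, h⟩
    · rw [← Perm.eq_inv_iff_eq.2 h, partner_zero, swap_self, ← Perm.one_def, mul_one,
        ← Perm.eq_inv_iff_eq.2 h, partner_zero, swap_self, ← Perm.one_def, mul_one]
    · rw [_root_.mul_inv_rev, Perm.mul_apply, ← Perm.eq_inv_iff_eq.2 h, partner_pair, swap_inv,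
        swap_apply_of_ne_of_ne (Fin.succ_ne_zero _), partner_pair, mul_assoc, Equiv.swap_mul_self,
        mul_one]
      intro e
      have := (pairEquiv n).injective (Fin.succ_injective _ e)
      fin_cases x <;> simp at this

include hA hA0 in
/-- The linear relations among the sub-maximal Pfaffians. -/
theorem sum_mul_pfaffianSum_submatrix :
    ∑ k : Fin (2 * n + 1),
      (-1) ^ (k : ℕ) * A j k * pfaffianSum (A.submatrix k.succAbove k.succAbove) = 0 := by
  rw [← sum_relationTerm A j hA hA0, ← (Equiv.ofBijective _ (insertPerm_bijective _)).sum_comp,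
    Fintype.sum_prod_type]
  refine Finset.sum_congr rfl fun k _ => ?_
  rw [pfaffianSum, Finset.mul_sum]
  refine Finset.sum_congr rfl fun σ _ => ?_
  simp only [relationTerm, ofBijective_apply, insertPerm_zero, insertPerm_succ, sign_insertPerm,
    submatrix_apply, zsmul_eq_mul]
  push_cast
  ring

end PfaffianRelation

section Split

variable {R : Type*} [CommRing R] {s m : ℕ}

/-- Splitting the indices into two consecutive blocks of even size. -/
def splitEquiv (s m : ℕ) : Fin (2 * s) ⊕ Fin (2 * m) ≃ Fin (2 * (s + m)) :=
  finSumFinEquiv.trans (finCongr (mul_add 2 s m).symm)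

/-- The sub-maximal Pfaffian sum with one index deleted. -/
def subPfaffianSum {n : ℕ} (A : Matrix (Fin (2 * n + 1)) (Fin (2 * n + 1)) R)
    (k : Fin (2 * n + 1)) : R :=
  pfaffianSum (A.submatrix k.succAbove k.succAbove)

/-- The determinant of the block of the last `2 * m` indices. -/
def lastBlockDet (s m : ℕ) (A : Matrix (Fin (2 * (s + m) + 1)) (Fin (2 * (s + m) + 1)) R) : R :=
  (A.submatrix (fun d => (splitEquiv s m (.inr d)).succ)
    fun d => (splitEquiv s m (.inr d)).succ).det

lemma map_subPfaffianSum {R' : Type*} [CommRing R'] (f : R →+* R') {n : ℕ}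
    (A : Matrix (Fin (2 * n + 1)) (Fin (2 * n + 1)) R) (k : Fin (2 * n + 1)) :
    f (subPfaffianSum A k) = subPfaffianSum (A.map f) k := by
  rw [subPfaffianSum, map_pfaffianSum]
  rfl

lemma map_lastBlockDet {R' : Type*} [CommRing R'] (f : R →+* R')
    (A : Matrix (Fin (2 * (s + m) + 1)) (Fin (2 * (s + m) + 1)) R) :
    f (lastBlockDet s m A) = lastBlockDet s m (A.map f) := by
  rw [lastBlockDet, RingHom.map_det]
  rfl

lemma sum_splitEquiv {M : Type*} [AddCommMonoid M] (f : Fin (2 * (s + m) + 1) → M) :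
    ∑ k, f k = f 0 + (∑ c, f (splitEquiv s m (.inl c)).succ +
      ∑ d, f (splitEquiv s m (.inr d)).succ) := by
  rw [Fin.sum_univ_succ, ← (splitEquiv s m).sum_comp, Fintype.sum_sum_type]

/-- The block determinant multiplies every sub-maximal Pfaffian into the ideal generated by the
complementary ones. -/
theorem lastBlockDet_mul_subPfaffianSum_mem
    (A : Matrix (Fin (2 * (s + m) + 1)) (Fin (2 * (s + m) + 1)) R)
    (hA : ∀ a b, A a b = -A b a) (hA0 : ∀ a, A a a = 0) (J : Ideal R)
    (h0 : subPfaffianSum A 0 ∈ J)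
    (hJ : ∀ c, subPfaffianSum A (splitEquiv s m (.inl c)).succ ∈ J) (k : Fin (2 * (s + m) + 1)) :
    lastBlockDet s m A * subPfaffianSum A k ∈ J := by
  induction k using Fin.cases with
  | zero => exact J.mul_mem_left _ h0
  | succ a =>
    obtain ⟨c | d, rfl⟩ := (splitEquiv s m).surjective a
    · exact J.mul_mem_left _ (hJ c)
    let r (d : Fin (2 * m)) : Fin (2 * (s + m) + 1) := (splitEquiv s m (.inr d)).succ
    let v (d : Fin (2 * m)) : R := (-1) ^ (r d : ℕ) * subPfaffianSum A (r d)
    have hv (e) : (A.submatrix r r *ᵥ v) e ∈ J := by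
      have h := sum_mul_pfaffianSum_submatrix A (r e) hA hA0
      rw [sum_splitEquiv, ← add_assoc, add_eq_zero_iff_neg_eq] at h
      have : (A.submatrix r r *ᵥ v) e = ∑ d, (-1) ^ (r d : ℕ) * A (r e) (r d) *
          pfaffianSum (A.submatrix (r d).succAbove (r d).succAbove) := by
        simp only [mulVec, dotProduct, v, subPfaffianSum, submatrix_apply]
        exact Finset.sum_congr rfl fun d _ => by ring
      rw [this, ← h]
      exact J.neg_mem (J.add_mem (J.mul_mem_left _ h0)
        (J.sum_mem fun c _ => J.mul_mem_left _ (hJ c)))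
    have hd : lastBlockDet s m A * v d =
        ((A.submatrix r r).adjugate *ᵥ (A.submatrix r r *ᵥ v)) d := by
      rw [mulVec_mulVec, adjugate_mul, smul_mulVec, one_mulVec]
      rfl
    have hmem : lastBlockDet s m A * v d ∈ J := by
      rw [hd]
      rw [mulVec, dotProduct]
      exact J.sum_mem fun e _ => J.mul_mem_left _ (hv e)
    have hsq : ((-1 : R) ^ (r d : ℕ)) * (-1) ^ (r d : ℕ) = 1 := by
      rw [← mul_pow]; simp
    have : lastBlockDet s m A * subPfaffianSum A (r d) =
        (-1) ^ (r d : ℕ) * (lastBlockDet s m A * v d) := by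
      simp only [v]
      linear_combination (-lastBlockDet s m A * subPfaffianSum A (r d)) * hsq
    rw [this]
    exact J.mul_mem_left _ hmem

end Split

section Specialization

variable {R : Type*} [CommRing R] {s m : ℕ} (z : Fin (2 * s) → R)
  (Z : Matrix (Fin (2 * s)) (Fin (2 * s)) R)

variable (m) in
/-- The identity matrix with an additional first row. -/
def bordered : Matrix (Fin (2 * (s + m) + 1)) (Fin (2 * (s + m))) R :=
  of (Fin.cons (Sum.elim z 0 ∘ (splitEquiv s m).symm)
    (of.symm (1 : Matrix (Fin (2 * (s + m))) (Fin (2 * (s + m))) R)))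

variable (m) in
/-- The block diagonal matrix with blocks a given matrix and the identity. -/
def extendOne : Matrix (Fin (2 * (s + m))) (Fin (2 * (s + m))) R :=
  (fromBlocks Z 0 0 1).submatrix (splitEquiv s m).symm (splitEquiv s m).symm

variable (m) in
/-- The alternating matrix used to test the independence of the sub-maximal Pfaffians. -/
def testMatrix : Matrix (Fin (2 * (s + m) + 1)) (Fin (2 * (s + m) + 1)) R :=
  bordered m z * extendOne m Z * standardAlternating R (s + m) * (bordered m z * extendOne m Z)ᵀ

lemma det_extendOne : (extendOne m Z).det = Z.det := by
  rw [extendOne, det_submatrix_equiv_self, det_fromBlocks_zero₂₁, det_one, mul_one]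

lemma bordered_zero_inl (c : Fin (2 * s)) :
    bordered m z 0 (splitEquiv s m (.inl c)) = z c := by
  rw [bordered, of_apply, Fin.cons_zero]
  simp

lemma bordered_zero_inr (d : Fin (2 * m)) :
    bordered m z 0 (splitEquiv s m (.inr d)) = 0 := by
  rw [bordered, of_apply, Fin.cons_zero]
  simp

lemma bordered_succ (a b : Fin (2 * (s + m))) :
    bordered m z a.succ b = (1 : Matrix _ _ R) a b := by
  rw [bordered, of_apply, Fin.cons_succ, of_symm_apply]

lemma det_bordered_succAbove_zero : ((bordered m z).submatrix (Fin.succAbove 0) id).det = 1 := by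
  have : (bordered m z).submatrix (Fin.succAbove 0) id = 1 := by
    ext a b
    simp [bordered_succ]
  rw [this, det_one]

lemma det_bordered_succAbove_inl (c : Fin (2 * s)) :
    ((bordered m z).submatrix (splitEquiv s m (.inl c)).succ.succAbove id).det =
      (-1) ^ (splitEquiv s m (.inl c) : ℕ) * z c := by
  set a := splitEquiv s m (.inl c)
  let M : Matrix (Fin (2 * (s + m) + 1)) (Fin (2 * (s + m) + 1)) R :=
    of fun k => Fin.cons (bordered m z k a) (bordered m z k)
  have hM : M.det = 0 := det_zero_of_column_eq (Fin.succ_ne_zero a).symm fun k => by simp [M]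
  rw [det_succ_column_zero] at hM
  have hsub (k : Fin (2 * (s + m) + 1)) :
      M.submatrix k.succAbove Fin.succ = (bordered m z).submatrix k.succAbove id := by
    ext i j
    simp [M]
  simp only [hsub] at hM
  rw [Fin.sum_univ_succ, det_bordered_succAbove_zero, Finset.sum_eq_single a] at hM
  · have h1 : M 0 0 = z c := by simp [M, a, bordered_zero_inl]
    have h2 : M a.succ 0 = 1 := by simp [M, bordered_succ]
    rw [h1, h2] at hM
    have hsq : ((-1 : R) ^ (a : ℕ)) * (-1) ^ (a : ℕ) = 1 := by
      rw [← mul_pow]; simp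
    simp only [Fin.val_zero, pow_zero, Fin.val_succ, pow_succ] at hM
    linear_combination (-((bordered m z).submatrix a.succ.succAbove id).det) * hsq -
      (-1) ^ (a : ℕ) * hM
  · intro b _ hb
    have : M b.succ 0 = 0 := by simp [M, bordered_succ, hb]
    rw [this]
    simp
  · simp

lemma subPfaffianSum_testMatrix (k : Fin (2 * (s + m) + 1)) :
    subPfaffianSum (testMatrix m z Z) k = ((bordered m z).submatrix k.succAbove id).det *
      Z.det * pfaffianSum (standardAlternating R (s + m)) := by
  have : (testMatrix m z Z).submatrix k.succAbove k.succAbove =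
      ((bordered m z).submatrix k.succAbove id * extendOne m Z) * standardAlternating R (s + m) *
        ((bordered m z).submatrix k.succAbove id * extendOne m Z)ᵀ := by
    rfl
  rw [subPfaffianSum, this, pfaffianSum_congruence, det_mul, det_extendOne]

lemma subPfaffianSum_testMatrix_zero :
    subPfaffianSum (testMatrix m z Z) 0 =
      Z.det * pfaffianSum (standardAlternating R (s + m)) := by
  rw [subPfaffianSum_testMatrix, det_bordered_succAbove_zero, one_mul]

lemma subPfaffianSum_testMatrix_inl (c : Fin (2 * s)) :
    subPfaffianSum (testMatrix m z Z) (splitEquiv s m (.inl c)).succ =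
      (-1) ^ (splitEquiv s m (.inl c) : ℕ) * z c *
        (Z.det * pfaffianSum (standardAlternating R (s + m))) := by
  rw [subPfaffianSum_testMatrix, det_bordered_succAbove_inl, mul_assoc]

lemma bordered_mul_extendOne_succ (a b : Fin (2 * (s + m))) :
    (bordered m z * extendOne m Z) a.succ b = extendOne m Z a b := by
  simp [mul_apply, bordered_succ, one_apply]

lemma extendOne_inr (d : Fin (2 * m)) (b : Fin (2 * (s + m))) :
    extendOne m Z (splitEquiv s m (.inr d)) b = (1 : Matrix _ _ R) (splitEquiv s m (.inr d)) b := by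
  obtain ⟨c | e, rfl⟩ := (splitEquiv s m).surjective b <;> simp [extendOne, one_apply]

lemma splitEquiv_inr_pairEquiv (i : Fin m) (x : Fin 2) :
    splitEquiv s m (.inr (pairEquiv m (i, x))) = pairEquiv (s + m) (Fin.natAdd s i, x) := by
  ext
  simp [splitEquiv, pairEquiv]
  ring

lemma standardAlternating_inr (d e : Fin (2 * m)) :
    standardAlternating R (s + m) (splitEquiv s m (.inr d)) (splitEquiv s m (.inr e)) =
      standardAlternating R m d e := by
  obtain ⟨⟨i, x⟩, rfl⟩ := (pairEquiv m).surjective d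
  obtain ⟨⟨j, y⟩, rfl⟩ := (pairEquiv m).surjective e
  simp only [splitEquiv_inr_pairEquiv, standardAlternating_pairEquiv, Fin.natAdd_inj]

lemma lastBlockDet_testMatrix : lastBlockDet s m (testMatrix m z Z) = 1 := by
  rw [lastBlockDet, ← det_standardAlternating (R := R) (n := m)]
  congr 1
  ext d e
  rw [submatrix_apply, testMatrix, mul_apply]
  simp only [transpose_apply, bordered_mul_extendOne_succ, mul_apply (M := _ * _),
    extendOne_inr, one_apply]
  simp [standardAlternating_inr]

lemma transpose_testMatrix : (testMatrix m z Z)ᵀ = -testMatrix m z Z := by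
  simp only [testMatrix, transpose_mul, transpose_transpose, transpose_standardAlternating]
  simp [Matrix.mul_assoc]

end Specialization

section GenericAlternating

open MvPolynomial

variable {K : Type} [Field K]

/-- A generic alternating matrix: the entries above the diagonal are the variables. -/
structure IsGenericAlternating {k : ℕ}
    (A : Matrix (Fin k) (Fin k) (MvPolynomial {p : Fin k × Fin k // p.1 < p.2} K)) : Prop where
  apply_of_lt : ∀ i j (h : i < j), A i j = X ⟨(i, j), h⟩
  apply_of_gt : ∀ i j (h : j < i), A i j = -X ⟨(j, i), h⟩
  apply_self : ∀ i, A i i = 0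

lemma IsGenericAlternating.apply_eq_neg {k : ℕ}
    {A : Matrix (Fin k) (Fin k) (MvPolynomial {p : Fin k × Fin k // p.1 < p.2} K)}
    (hA : IsGenericAlternating A) (i j : Fin k) : A i j = -A j i := by
  rcases lt_trichotomy i j with h | rfl | h
  · rw [hA.apply_of_lt i j h, hA.apply_of_gt j i h, neg_neg]
  · rw [hA.apply_self, neg_zero]
  · rw [hA.apply_of_lt j i h, hA.apply_of_gt i j h]

/-- Specializing a generic alternating matrix. -/
noncomputable def specialize {k : ℕ} {R : Type} [CommRing R] [Algebra K R]
    (B : Matrix (Fin k) (Fin k) R) : MvPolynomial {p : Fin k × Fin k // p.1 < p.2} K →ₐ[K] R :=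
  aeval fun p => B p.1.1 p.1.2

lemma IsGenericAlternating.map_specialize {k : ℕ} {R : Type} [CommRing R] [IsDomain R] [CharZero R]
    [Algebra K R] {A : Matrix (Fin k) (Fin k) (MvPolynomial {p : Fin k × Fin k // p.1 < p.2} K)}
    (hA : IsGenericAlternating A) {B : Matrix (Fin k) (Fin k) R} (hB : Bᵀ = -B) :
    A.map (specialize (K := K) B : _ →+* R) = B := by
  have hB' (i j) : B j i = -B i j := congrFun (congrFun hB i) j
  ext i j
  rw [map_apply]
  rcases lt_trichotomy i j with h | rfl | h
  · simp [hA.apply_of_lt i j h, specialize]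
  · rw [hA.apply_self, map_zero]
    exact (self_eq_neg.1 (hB' i i)).symm
  · simp [hA.apply_of_gt i j h, specialize, hB' i j]

variable {s m : ℕ}

/-- The specialization at the test matrix with generic row vector and generic matrix. -/
noncomputable def genericTestMatrix (K : Type) [Field K] (s m : ℕ) :
    Matrix (Fin (2 * (s + m) + 1)) (Fin (2 * (s + m) + 1))
      (MvPolynomial (Fin (2 * s) × Fin (2 * s)) (MvPolynomial (Fin (2 * s)) K)) :=
  testMatrix m (fun c => C (X c)) (mvPolynomialX _ _ _)

lemma genericTestMatrix_mem_range (a b : Fin (2 * (s + m) + 1)) :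
    genericTestMatrix K s m a b ∈ (genericRowHom (2 * s) K).range := by
  have hX (c d : Fin (2 * s)) : X (c, d) ∈ (genericRowHom (2 * s) K).range :=
    ⟨C (X (c, d)), by simp [genericRowHom]⟩
  have hrow (d : Fin (2 * s)) : genericRowMul K d ∈ (genericRowHom (2 * s) K).range :=
    ⟨X d, by simp [genericRowHom]⟩
  have hext (a b : Fin (2 * (s + m))) :
      extendOne m (mvPolynomialX (Fin (2 * s)) (Fin (2 * s)) (MvPolynomial (Fin (2 * s)) K)) a b ∈
        (genericRowHom (2 * s) K).range := by
    obtain ⟨a | a, rfl⟩ := (splitEquiv s m).surjective a <;>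
    obtain ⟨b | b, rfl⟩ := (splitEquiv s m).surjective b
    · simpa [extendOne] using hX a b
    · simp [extendOne, zero_mem]
    · simp [extendOne, zero_mem]
    · by_cases h : a = b <;> simp [extendOne, zero_mem, one_mem, h]
  have hW (a b) : (bordered m (fun c : Fin (2 * s) =>
      (C (X c) : MvPolynomial (Fin (2 * s) × Fin (2 * s)) (MvPolynomial (Fin (2 * s)) K))) *
      extendOne m (mvPolynomialX (Fin (2 * s)) (Fin (2 * s)) (MvPolynomial (Fin (2 * s)) K))) a b ∈
      (genericRowHom (2 * s) K).range := by
    induction a using Fin.cases with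
    | succ a =>
      rw [bordered_mul_extendOne_succ]
      exact hext a b
    | zero =>
      rw [mul_apply, ← (splitEquiv s m).sum_comp, Fintype.sum_sum_type]
      simp only [bordered_zero_inl, bordered_zero_inr, zero_mul, Finset.sum_const_zero, add_zero]
      obtain ⟨b | b, rfl⟩ := (splitEquiv s m).surjective b
      · simpa [extendOne, genericRowMul] using hrow b
      · simp [extendOne, zero_mem]
  have hΩ (a b) : standardAlternating (MvPolynomial (Fin (2 * s) × Fin (2 * s))
      (MvPolynomial (Fin (2 * s)) K)) (s + m) a b ∈ (genericRowHom (2 * s) K).range := by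
    obtain ⟨⟨i, x⟩, rfl⟩ := (pairEquiv _).surjective a
    obtain ⟨⟨j, y⟩, rfl⟩ := (pairEquiv _).surjective b
    rw [standardAlternating_pairEquiv]
    split_ifs
    · fin_cases x <;> fin_cases y <;> simp [zero_mem, one_mem]
    · exact zero_mem _
  rw [genericTestMatrix, testMatrix, mul_apply]
  simp only [mul_apply (M := _ * _), transpose_apply]
  exact sum_mem fun c _ => mul_mem (sum_mem fun d _ => mul_mem (hW a d) (hΩ d c)) (hW b c)

lemma specialize_genericTestMatrix_mem_range
    (p : MvPolynomial {p : Fin (2 * (s + m) + 1) × Fin (2 * (s + m) + 1) // p.1 < p.2} K) :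
    specialize (genericTestMatrix K s m) p ∈ (genericRowHom (2 * s) K).range := by
  induction p using MvPolynomial.induction_on with
  | C c => exact ⟨C (C c), by simp [specialize, genericRowHom, MvPolynomial.algebraMap_apply]⟩
  | add p q hp hq => rw [map_add]; exact add_mem hp hq
  | mul_X p i hp =>
    rw [map_mul]
    refine mul_mem hp ?_
    rw [specialize, aeval_X]
    exact genericTestMatrix_mem_range _ _

lemma powIdeal_ofFn {R : Type} [CommRing R] {k : ℕ} (v : Fin k → R) (c : ℕ) :
    powIdeal (List.ofFn v) c = Ideal.span (Set.range fun i => v i ^ c) := by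
  rw [powIdeal]
  congr 1
  ext y
  simp [List.mem_ofFn]

/-- The sub-maximal Pfaffian sums obtained by deleting one of the first `2 * s + 1` indices. -/
def leadingPfaffianSums {R : Type*} [CommRing R] (s m : ℕ)
    (A : Matrix (Fin (2 * (s + m) + 1)) (Fin (2 * (s + m) + 1)) R) : Fin (2 * s + 1) → R :=
  Fin.cons (subPfaffianSum A 0) fun c => subPfaffianSum A (splitEquiv s m (.inl c)).succ

variable [CharZero K]
  {A : Matrix (Fin (2 * (s + m) + 1)) (Fin (2 * (s + m) + 1))
    (MvPolynomial {p : Fin (2 * (s + m) + 1) × Fin (2 * (s + m) + 1) // p.1 < p.2} K)}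

lemma IsGenericAlternating.lastBlockDet_pow_notMem (hA : IsGenericAlternating A) (hs : 1 ≤ s)
    (r : ℕ) : lastBlockDet s m A ^ r ∉ Ideal.span (Set.range (leadingPfaffianSums s m A)) := by
  intro h
  let φ : MvPolynomial {p : Fin (2 * (s + m) + 1) × Fin (2 * (s + m) + 1) // p.1 < p.2} K →+* K :=
    specialize (K := K) (testMatrix m (0 : Fin (2 * s) → K) 0)
  have hφ : A.map φ = testMatrix m (0 : Fin (2 * s) → K) 0 :=
    hA.map_specialize (transpose_testMatrix _ _)
  have : Nonempty (Fin (2 * s)) := ⟨⟨0, by omega⟩⟩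
  have hker : Ideal.span (Set.range (leadingPfaffianSums s m A)) ≤ RingHom.ker φ := by
    rw [Ideal.span_le]
    rintro _ ⟨i, rfl⟩
    rw [SetLike.mem_coe, RingHom.mem_ker]
    induction i using Fin.cases <;>
      simp [leadingPfaffianSums, map_subPfaffianSum, hφ, subPfaffianSum_testMatrix]
  have h1 := hker h
  rw [RingHom.mem_ker, map_pow, map_lastBlockDet, hφ, lastBlockDet_testMatrix, one_pow] at h1
  exact one_ne_zero h1

lemma cancel_pow_of_sum_pow_eq {R ι : Type*} [CommRing R] [IsDomain R] [Fintype ι] {b w : ℕ}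
    (hw : Fintype.card ι * (b + 1) = w + 1) {d k a₀ : R} {a e x : ι → R} (hu : d * k ≠ 0)
    (h : a₀ * (d * k) ^ (b + 2) + ∑ c, a c * (e c * x c * (d * k)) ^ (b + 2) =
      (d * k * ∏ c, e c * x c * (d * k)) ^ (b + 1)) :
    k ^ w * (∏ c, e c ^ (b + 1)) * (∏ c, x c ^ (b + 1)) * d ^ w =
      ∑ c, x c ^ (b + 2) * (a c * e c ^ (b + 2)) + a₀ := by
  refine mul_left_cancel₀ (pow_ne_zero (b + 2) hu) ?_
  have hpow : (d * k) ^ (b + 2) * (d * k) ^ w =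
      (d * k) ^ (b + 1) * ∏ _c : ι, (d * k) ^ (b + 1) := by
    rw [Finset.prod_const, Finset.card_univ, ← pow_mul, ← pow_add, ← pow_add,
      mul_comm (b + 1), hw]
    congr 1
    ring
  have hsum : (d * k) ^ (b + 2) * ∑ c, x c ^ (b + 2) * (a c * e c ^ (b + 2)) =
      ∑ c, a c * (e c * x c * (d * k)) ^ (b + 2) := by
    rw [Finset.mul_sum]
    exact Finset.sum_congr rfl fun c _ => by ring
  rw [mul_add, hsum, add_comm (∑ c, _), mul_comm _ a₀, h]
  simp only [mul_pow _ _ (b + 1), ← Finset.prod_pow, Finset.prod_mul_distrib] at hpow ⊢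
  linear_combination (∏ c, e c ^ (b + 1)) * (∏ c, x c ^ (b + 1)) * hpow

lemma IsGenericAlternating.pow_mul_prod_pow_notMem (hA : IsGenericAlternating A) (hs : 1 ≤ s)
    (b r : ℕ) : lastBlockDet s m A ^ r * (∏ i, leadingPfaffianSums s m A i) ^ (b + 1) ∉
      Ideal.span (Set.range fun i => leadingPfaffianSums s m A i ^ (b + 2)) := by
  intro h
  obtain ⟨a, ha⟩ := Ideal.mem_span_range_iff_exists_fun.1 h
  let φ : MvPolynomial {p : Fin (2 * (s + m) + 1) × Fin (2 * (s + m) + 1) // p.1 < p.2} K →+*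
      MvPolynomial (Fin (2 * s) × Fin (2 * s)) (MvPolynomial (Fin (2 * s)) K) :=
    specialize (K := K) (genericTestMatrix K s m)
  have hφ : A.map φ = genericTestMatrix K s m := hA.map_specialize (transpose_testMatrix _ _)
  let δ := (mvPolynomialX (Fin (2 * s)) (Fin (2 * s)) (MvPolynomial (Fin (2 * s)) K)).det
  let κ : K := (pfaffianSum (standardAlternating ℤ (s + m)) : ℤ)
  have hκ : κ ≠ 0 := Int.cast_ne_zero.2 pfaffianSum_standardAlternating_pos.ne'
  let e (c : Fin (2 * s)) : K := (-1) ^ (splitEquiv s m (.inl c) : ℕ)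
  let u := δ * C (C κ)
  have hu : u ≠ 0 := mul_ne_zero (det_mvPolynomialX_ne_zero _ _) (by simpa using hκ)
  have hκ' : pfaffianSum (standardAlternating (MvPolynomial (Fin (2 * s) × Fin (2 * s))
      (MvPolynomial (Fin (2 * s)) K)) (s + m)) = C (C κ) := by
    rw [pfaffianSum_standardAlternating]
    simp [κ]
  have h0 : φ (leadingPfaffianSums s m A 0) = u := by
    rw [leadingPfaffianSums, Fin.cons_zero, map_subPfaffianSum, hφ, genericTestMatrix,
      subPfaffianSum_testMatrix_zero, hκ']
  have hc (c) : φ (leadingPfaffianSums s m A c.succ) = C (C (e c)) * C (X c) * u := by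
    rw [leadingPfaffianSums, Fin.cons_succ, map_subPfaffianSum, hφ, genericTestMatrix,
      subPfaffianSum_testMatrix_inl, hκ']
    simp [e, u, δ]
  have hg : φ (lastBlockDet s m A) = 1 := by
    rw [map_lastBlockDet, hφ, genericTestMatrix, lastBlockDet_testMatrix]
  obtain ⟨G, hG⟩ := specialize_genericTestMatrix_mem_range (a 0)
  replace hG : genericRowHom (2 * s) K G = φ (a 0) := hG
  have hφa := congrArg φ ha
  rw [Fin.sum_univ_succ, Fin.prod_univ_succ] at hφa
  simp only [map_add, map_mul, map_sum, map_pow, map_prod, h0, hc, hg, one_pow, one_mul] at hφa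
  obtain ⟨w, hw⟩ : ∃ w, 2 * s * (b + 1) = w + 1 :=
    Nat.exists_eq_succ_of_ne_zero (by positivity)
  refine det_pow_mul_prod_pow_ne (t := b + 1) (w := w) (by omega)
    (c := κ ^ w * ∏ c, e c ^ (b + 1)) (mul_ne_zero (pow_ne_zero _ hκ)
      (Finset.prod_ne_zero_iff.2 fun c _ => by simp [e]))
    (fun c => φ (a c.succ) * C (C (e c)) ^ (b + 2)) G ?_
  rw [hG]
  simpa only [map_mul, map_prod, map_pow] using
    cancel_pow_of_sum_pow_eq (by simpa using hw) hu hφa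

lemma IsGenericAlternating.isPowIndep (hA : IsGenericAlternating A) (hs : 1 ≤ s) :
    IsPowIndep (lastBlockDet s m A) (List.ofFn (leadingPfaffianSums s m A))
      (1 : MvPolynomial {p : Fin (2 * (s + m) + 1) × Fin (2 * (s + m) + 1) // p.1 < p.2} K) := by
  intro b r
  rw [smul_eq_mul, smul_eq_mul, smul_eq_mul, mul_one, Ideal.mul_top, powIdeal_ofFn, List.prod_ofFn]
  cases b with
  | zero => simpa using hA.lastBlockDet_pow_notMem hs r
  | succ b => exact hA.pow_mul_prod_pow_notMem hs b r

end GenericAlternating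

end Matrix

open MvPolynomial

/-- The local cohomology modules of the polynomial ring in the entries of the generic
`(2n+1) × (2n+1)` skew-symmetric matrix, with support in the ideal of sub-maximal
Pfaffians, are nonzero in all degrees `2s + 1` for `1 ≤ s ≤ n`. -/
theorem local_cohomology_submaximal_pfaffians_nonvanishing
    (K : Type) [Field K] [CharZero K] (n : ℕ) (hn : 1 ≤ n)
    (X : Matrix (Fin (2 * n + 1)) (Fin (2 * n + 1))
      (MvPolynomial {p : Fin (2 * n + 1) × Fin (2 * n + 1) // p.1 < p.2} K))
    (hXlt : ∀ (i j : Fin (2 * n + 1)) (h : i < j), X i j = MvPolynomial.X ⟨(i, j), h⟩)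
    (hXgt : ∀ (i j : Fin (2 * n + 1)) (h : j < i), X i j = -MvPolynomial.X ⟨(j, i), h⟩)
    (hXdiag : ∀ i, X i i = 0)
    (pf : Matrix (Fin (2 * n)) (Fin (2 * n))
        (MvPolynomial {p : Fin (2 * n + 1) × Fin (2 * n + 1) // p.1 < p.2} K) →
      MvPolynomial {p : Fin (2 * n + 1) × Fin (2 * n + 1) // p.1 < p.2} K)
    (hpf : ∀ A, pf A = (((2 ^ n * Nat.factorial n : ℕ) : K)⁻¹) •
      ∑ σ : Equiv.Perm (Fin (2 * n)), (Equiv.Perm.sign σ : ℤ) •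
        ∏ i : Fin n, A (σ ⟨2 * (i : ℕ), by omega⟩) (σ ⟨2 * (i : ℕ) + 1, by omega⟩))
    (I : Ideal (MvPolynomial {p : Fin (2 * n + 1) × Fin (2 * n + 1) // p.1 < p.2} K))
    (hI : I = Ideal.span (Set.range fun k : Fin (2 * n + 1) =>
      pf (X.submatrix (Fin.succAbove k) (Fin.succAbove k))))
    (s : ℕ) (hs1 : 1 ≤ s) (hsn : s ≤ n) :
    Nontrivial ((localCohomology I (2 * s + 1)).obj
      (ModuleCat.of (MvPolynomial {p : Fin (2 * n + 1) × Fin (2 * n + 1) // p.1 < p.2} K) (MvPolynomial {p : Fin (2 * n + 1) × Fin (2 * n + 1) // p.1 < p.2} K))) := by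
  obtain ⟨m, rfl⟩ := Nat.exists_eq_add_of_le hsn
  have hX : X.IsGenericAlternating := ⟨hXlt, hXgt, hXdiag⟩
  let c : K := ((2 ^ (s + m) * Nat.factorial (s + m) : ℕ) : K)
  have hc : c ≠ 0 := Nat.cast_ne_zero.2 (by positivity)
  have hpf' (k) : pf (X.submatrix k.succAbove k.succAbove) = c⁻¹ • X.subPfaffianSum k := by
    rw [hpf, Matrix.subPfaffianSum, Matrix.pfaffianSum]
    refine congrArg _ (Finset.sum_congr rfl fun σ _ =>
      congrArg _ (Finset.prod_congr rfl fun i _ => ?_))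
    congr 2 <;> ext
    · exact (Matrix.pairEquiv_zero_val i).symm
    · exact (Matrix.pairEquiv_one_val i).symm
  have hmem (k) : X.subPfaffianSum k ∈ I := by
    rw [← smul_inv_smul₀ hc (X.subPfaffianSum k), ← hpf', hI, MvPolynomial.smul_eq_C_mul]
    exact Ideal.mul_mem_left _ _ (Ideal.subset_span ⟨k, rfl⟩)
  refine nontrivial_localCohomology_of_isPowIndep (fun f hf => ?_) (fun x hx => ?_)
    (hX.isPowIndep hs1) List.length_ofFn
  · obtain ⟨i, rfl⟩ := List.mem_ofFn.1 hf
    induction i using Fin.cases <;> exact hmem _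
  · rw [hI] at hx
    induction hx using Submodule.span_induction with
    | zero => rw [mul_zero]; exact zero_mem _
    | add x y _ _ hx hy => rw [mul_add (Matrix.lastBlockDet s m X)]; exact add_mem hx hy
    | smul a x _ hx => rw [mul_smul_comm]; exact Ideal.mul_mem_left _ _ hx
    | mem x hx =>
      obtain ⟨k, rfl⟩ := hx
      have hmemL (i) : Matrix.leadingPfaffianSums s m X i ∈
          Ideal.span {f | f ∈ List.ofFn (Matrix.leadingPfaffianSums s m X)} :=
        Ideal.subset_span (List.mem_ofFn.2 ⟨i, rfl⟩)
      dsimp only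
      rw [hpf', mul_smul_comm, MvPolynomial.smul_eq_C_mul]
      exact Ideal.mul_mem_left _ _ (Matrix.lastBlockDet_mul_subPfaffianSum_mem X hX.apply_eq_neg
        hX.apply_self _ (hmemL 0) (fun i => hmemL i.succ) k)
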